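/- Let k > 0 be real, let Ω ⊂ ℝ³ be a bounded open set, and let p : ℝ³ → ℂ be a continuous function supported in the closure of Ω with Im p(y) ≤ 0 for all y. If u : ℝ³ → ℂ is a bounded continuous function satisfying the homogeneous limiting integral equation u(x) = − ∫_Ω exp(i k ‖x − y‖)/(4π ‖x − y‖) p(y) u(y) dy for all x ∈ ℝ³, then u is identically zero. Consequently, the limiting integral equation u(x) = u₀(x) − ∫_Ω G(x,y) p(y) u(y) dy has at most one bounded continuous solution for any given u₀. -/

import Mathlib

open MeasureTheory Filter Real
open scoped Topology

noncomputable section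

/-- Euclidean 3-space. -/
abbrev E3 := EuclideanSpace ℝ (Fin 3)

/-- The free-space Green's function of the Helmholtz operator `Δ + k²` in `ℝ³`. -/
def greens (k : ℝ) (x y : E3) : ℂ :=
  Complex.exp (Complex.I * (k : ℂ) * (‖x - y‖ : ℂ)) / ((4 * Real.pi * ‖x - y‖ : ℝ) : ℂ)

/-! ### Bessel-type integrals -/

/-- The `n`-th derivative of `w ↦ ∫ exp (i w cos φ) dφ`, i.e. of `2π` times the Bessel function
`J₀`. -/
def besselInt (n : ℕ) (w : ℂ) : ℂ :=
  ∫ φ in (0 : ℝ)..(2 * Real.pi), (Complex.I * Real.cos φ) ^ n *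
    Complex.exp (Complex.I * w * Real.cos φ)

lemma norm_exp_I_mul_cos_le (w : ℂ) (φ : ℝ) :
    ‖Complex.exp (Complex.I * w * Real.cos φ)‖ ≤ Real.exp |w.im| := by
  rw [Complex.norm_exp]
  apply Real.exp_le_exp.2
  have h : (Complex.I * w * Real.cos φ).re = - w.im * Real.cos φ := by
    simp [Complex.mul_re, Complex.mul_im, Complex.cos_ofReal_re, Complex.cos_ofReal_im]
  rw [h]
  calc -w.im * Real.cos φ ≤ |-w.im * Real.cos φ| := le_abs_self _
    _ = |w.im| * |Real.cos φ| := by rw [abs_mul, abs_neg]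
    _ ≤ |w.im| * 1 := by gcongr; exact Real.abs_cos_le_one φ
    _ = |w.im| := mul_one _

lemma norm_I_mul_cos_pow_le (n : ℕ) (φ : ℝ) : ‖(Complex.I * Real.cos φ : ℂ) ^ n‖ ≤ 1 := by
  rw [norm_pow, norm_mul, Complex.norm_I, one_mul, Complex.norm_real, Real.norm_eq_abs]
  exact pow_le_one₀ (abs_nonneg _) (Real.abs_cos_le_one φ)

lemma norm_besselInt_le (n : ℕ) (w : ℂ) :
    ‖besselInt n w‖ ≤ 2 * Real.pi * Real.exp |w.im| := by
  have h := intervalIntegral.norm_integral_le_of_norm_le_const (a := 0) (b := 2 * Real.pi)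
    (C := Real.exp |w.im|) (f := fun φ : ℝ => (Complex.I * Real.cos φ) ^ n *
      Complex.exp (Complex.I * w * Real.cos φ)) (fun φ _ => by
      rw [norm_mul]
      calc _ ≤ 1 * Real.exp |w.im| := by
            gcongr
            · exact norm_I_mul_cos_pow_le n φ
            · exact norm_exp_I_mul_cos_le w φ
        _ = _ := one_mul _)
  rw [sub_zero, abs_of_pos Real.two_pi_pos] at h
  unfold besselInt
  linarith

lemma hasDerivAt_besselInt (n : ℕ) (w : ℂ) :
    HasDerivAt (besselInt n) (besselInt (n + 1) w) w := by
  refine (intervalIntegral.hasDerivAt_integral_of_dominated_loc_of_deriv_le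
    (s := Metric.ball w 1) (bound := fun _ => Real.exp (|w.im| + 1))
    (F := fun w φ => (Complex.I * Real.cos φ) ^ n * Complex.exp (Complex.I * w * Real.cos φ))
    (F' := fun w φ => (Complex.I * Real.cos φ) ^ (n + 1) *
      Complex.exp (Complex.I * w * Real.cos φ))
    (Metric.ball_mem_nhds w one_pos) ?_ ?_ ?_ ?_ ?_ ?_).2
  · exact .of_forall fun v => (by fun_prop : Continuous _).aestronglyMeasurable
  · exact (by fun_prop : Continuous _).intervalIntegrable _ _
  · exact (by fun_prop : Continuous _).aestronglyMeasurable
  · refine .of_forall fun φ _ v hv => ?_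
    rw [norm_mul]
    calc _ ≤ 1 * Real.exp |v.im| := by
          gcongr
          · exact norm_I_mul_cos_pow_le _ φ
          · exact norm_exp_I_mul_cos_le v φ
      _ ≤ _ := by
          rw [one_mul]
          apply Real.exp_le_exp.2
          have h1 : |v.im - w.im| ≤ ‖v - w‖ := Complex.abs_im_le_norm (v - w)
          have h2 : ‖v - w‖ < 1 := by simpa [dist_eq_norm] using hv
          have h3 := abs_sub_abs_le_abs_sub v.im w.im
          linarith
  · exact intervalIntegrable_const
  · refine .of_forall fun φ _ v _ => ?_
    have h : HasDerivAt (fun w : ℂ => Complex.I * w * Real.cos φ) (Complex.I * Real.cos φ) v := by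
      simpa using ((hasDerivAt_id v).const_mul Complex.I).mul_const (Real.cos φ : ℂ)
    convert! h.cexp.const_mul ((Complex.I * Real.cos φ) ^ n) using 1
    ring

lemma continuous_besselInt (n : ℕ) : Continuous (besselInt n) :=
  (show Differentiable ℂ (besselInt n) from
    fun w => (hasDerivAt_besselInt n w).differentiableAt).continuous

lemma besselInt_zero_zero : besselInt 0 0 = 2 * Real.pi := by
  simp [besselInt]

/-- Bessel's equation. -/
lemma besselInt_equation (w : ℂ) :
    w * besselInt 2 w = - besselInt 1 w - w * besselInt 0 w := by
  have h : ∫ φ in (0 : ℝ)..(2 * Real.pi),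
      ((Real.cos φ : ℂ) * Complex.exp (Complex.I * w * Real.cos φ) +
      Real.sin φ * (Complex.exp (Complex.I * w * Real.cos φ) *
        (Complex.I * w * -Real.sin φ))) = 0 := by
    rw [intervalIntegral.integral_eq_sub_of_hasDerivAt
      (f := fun φ : ℝ => (Real.sin φ : ℂ) * Complex.exp (Complex.I * w * Real.cos φ))]
    · simp
    · intro φ _
      have hs : HasDerivAt (fun φ : ℝ => (Real.sin φ : ℂ)) (Real.cos φ : ℂ) φ :=
        (Real.hasDerivAt_sin φ).ofReal_comp
      have hc : HasDerivAt (fun φ : ℝ => (Real.cos φ : ℂ)) (-Real.sin φ : ℂ) φ := by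
        simpa using (Real.hasDerivAt_cos φ).ofReal_comp
      exact hs.mul (hc.const_mul (Complex.I * w)).cexp
    · exact (by fun_prop : Continuous _).intervalIntegrable _ _
  have h2 : w * besselInt 2 w + besselInt 1 w + w * besselInt 0 w = 0 := by
    rw [show (0 : ℂ) = Complex.I * 0 by simp, ← h]
    simp only [besselInt, ← intervalIntegral.integral_const_mul]
    rw [← intervalIntegral.integral_add, ← intervalIntegral.integral_add]
    · apply intervalIntegral.integral_congr
      intro φ _
      have h3 : (Real.sin φ : ℂ) ^ 2 = 1 - (Real.cos φ : ℂ) ^ 2 := by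
        rw [eq_sub_iff_add_eq]; exact_mod_cast Real.sin_sq_add_cos_sq φ
      have h4 : Complex.I ^ 2 = -1 := Complex.I_sq
      linear_combination (Complex.exp (Complex.I * w * Real.cos φ) * w) * (-h3) +
        (Complex.exp (Complex.I * w * Real.cos φ) * w) * (Real.sin φ ^ 2 + Real.cos φ ^ 2) * h4
    all_goals exact (by fun_prop : Continuous _).intervalIntegrable _ _
  linear_combination h2

/-- The angular average of a plane wave over a circle. -/
lemma integral_exp_circle (w : ℂ) (a b : ℝ) :
    ∫ φ in (0 : ℝ)..(2 * Real.pi),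
      Complex.exp (Complex.I * w * (a * Real.cos φ + b * Real.sin φ)) =
      besselInt 0 (w * ‖(⟨a, b⟩ : ℂ)‖) := by
  set ζ : ℂ := ⟨a, b⟩
  have ha : a = ‖ζ‖ * Real.cos ζ.arg := (Complex.norm_mul_cos_arg ζ).symm
  have hb : b = ‖ζ‖ * Real.sin ζ.arg := (Complex.norm_mul_sin_arg ζ).symm
  have hp : Function.Periodic (fun φ : ℝ => Complex.exp (Complex.I * (w * ‖ζ‖) * Real.cos φ))
      (2 * Real.pi) := by
    intro φ
    simp only [Real.cos_add_two_pi]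
  have h1 : ∀ φ : ℝ, Complex.exp (Complex.I * w * (a * Real.cos φ + b * Real.sin φ)) =
      Complex.exp (Complex.I * (w * ‖ζ‖) * Real.cos (φ - ζ.arg)) := by
    intro φ
    rw [Real.cos_sub]
    congr 1
    have : (a : ℂ) * Real.cos φ + b * Real.sin φ = ((a * Real.cos φ + b * Real.sin φ : ℝ) : ℂ) := by
      push_cast; rfl
    rw [this]
    conv_lhs => rw [ha, hb]
    push_cast
    ring
  simp only [h1, besselInt, pow_zero, one_mul]
  rw [intervalIntegral.integral_comp_sub_right
    (fun φ : ℝ => Complex.exp (Complex.I * (w * ‖ζ‖) * Real.cos φ))]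
  have := hp.intervalIntegral_add_eq (0 - ζ.arg) 0
  rw [zero_add] at this
  rw [← this]
  congr 1
  ring

/-! ### Integrals of plane waves over cones of directions -/

/-- The average over a circle of directions of a plane wave, at height `z` and distance `ρ` from
the axis; `s` and `q` are the cosine and the sine of the (possibly complex) aperture. -/
def coneWave (k z ρ : ℝ) (s q : ℂ) : ℂ :=
  Complex.exp (Complex.I * k * s * z) * besselInt 0 (k * q * ρ)

/-- The derivative of `coneWave` under rotation in the `(z, ρ)`-plane. -/
def coneWaveRot (k z ρ : ℝ) (s q : ℂ) : ℂ :=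
  Complex.exp (Complex.I * k * s * z) *
    (-(Complex.I * k * s * ρ) * besselInt 0 (k * q * ρ) + k * q * z * besselInt 1 (k * q * ρ))

lemma hasDerivAt_coneWave (k r : ℝ) (s q : ℂ) (α : ℝ) :
    HasDerivAt (fun α => coneWave k (r * Real.cos α) (r * Real.sin α) s q)
      (coneWaveRot k (r * Real.cos α) (r * Real.sin α) s q) α := by
  have hc : HasDerivAt (fun α : ℝ => ((r * Real.cos α : ℝ) : ℂ)) ((r * -Real.sin α : ℝ) : ℂ) α :=
    ((Real.hasDerivAt_cos α).const_mul r).ofReal_comp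
  have hs : HasDerivAt (fun α : ℝ => ((r * Real.sin α : ℝ) : ℂ)) ((r * Real.cos α : ℝ) : ℂ) α :=
    ((Real.hasDerivAt_sin α).const_mul r).ofReal_comp
  have h1 := (hc.const_mul (Complex.I * k * s)).cexp
  have h2 := HasDerivAt.comp α (hasDerivAt_besselInt 0 (k * q * (r * Real.sin α : ℝ)))
    (hs.const_mul (k * q))
  convert! h1.mul h2 using 1
  simp only [coneWaveRot, Function.comp, zero_add]
  push_cast
  ring

/-- `coneWaveRot` is a total derivative in the aperture. -/
lemma hasDerivAt_aperture (k z ρ : ℝ) {s q : ℝ → ℂ} {c q' : ℂ} {t : ℝ} (hs : HasDerivAt s c t)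
    (hq : HasDerivAt q q' t) (hsq : q t * q' = -(s t * c)) :
    HasDerivAt (fun t => q t * besselInt 1 (k * q t * ρ) * Complex.exp (Complex.I * k * s t * z))
      (Complex.I * c * coneWaveRot k z ρ (s t) (q t)) t := by
  have h1 := ((hs.const_mul (Complex.I * k)).mul_const (z : ℂ)).cexp
  have h2 := HasDerivAt.comp t (hasDerivAt_besselInt 1 (k * q t * ρ))
    ((hq.const_mul (k : ℂ)).mul_const (ρ : ℂ))
  convert! (hq.mul h2).mul h1 using 1
  have h3 := besselInt_equation (k * q t * ρ)
  have h4 : Complex.I ^ 2 = -1 := Complex.I_sq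
  simp only [coneWaveRot, Function.comp, Nat.reduceAdd, Pi.mul_apply]
  linear_combination Complex.exp (Complex.I * k * s t * z) * (-q' * h3 +
    k * ρ * besselInt 0 (k * q t * ρ) * hsq - c * k * s t * ρ * besselInt 0 (k * q t * ρ) * h4)

lemma norm_coneWave_le {k z ρ : ℝ} {s q : ℂ} {A B : ℝ}
    (hA : ‖Complex.exp (Complex.I * k * s * z)‖ ≤ A) (hB : Real.exp |(k * q * ρ).im| ≤ B) :
    ‖coneWave k z ρ s q‖ ≤ A * (2 * Real.pi * B) := by
  rw [coneWave, norm_mul]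
  gcongr
  · exact (norm_nonneg _).trans hA
  · exact (norm_besselInt_le _ _).trans (by gcongr)

lemma norm_coneWaveRot_le {k z ρ : ℝ} {s q : ℂ} {A B S r : ℝ}
    (hA : ‖Complex.exp (Complex.I * k * s * z)‖ ≤ A) (hB : Real.exp |(k * q * ρ).im| ≤ B)
    (hs : ‖s‖ ≤ S) (hq : ‖q‖ ≤ S) (hz : |z| ≤ r) (hρ : |ρ| ≤ r) :
    ‖coneWaveRot k z ρ s q‖ ≤ A * (2 * (|k| * S * r) * (2 * Real.pi * B)) := by
  have hS : 0 ≤ S := (norm_nonneg _).trans hs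
  have hr : 0 ≤ r := (abs_nonneg _).trans hz
  have hb : ∀ n, ‖besselInt n (k * q * ρ)‖ ≤ 2 * Real.pi * B := fun n =>
    (norm_besselInt_le _ _).trans (by gcongr)
  rw [coneWaveRot, norm_mul]
  have h1 : ‖-(Complex.I * k * s * ρ) * besselInt 0 (k * q * ρ)‖ ≤
      (|k| * S * r) * (2 * Real.pi * B) := by
    rw [norm_mul]
    gcongr
    · rw [norm_neg, norm_mul, norm_mul, norm_mul, Complex.norm_I, one_mul, Complex.norm_real,
        Complex.norm_real, Real.norm_eq_abs, Real.norm_eq_abs]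
      gcongr
    · exact hb 0
  have h2 : ‖(k * q * z : ℂ) * besselInt 1 (k * q * ρ)‖ ≤
      (|k| * S * r) * (2 * Real.pi * B) := by
    rw [norm_mul]
    gcongr
    · rw [norm_mul, norm_mul, Complex.norm_real, Complex.norm_real, Real.norm_eq_abs,
        Real.norm_eq_abs]
      gcongr
    · exact hb 1
  gcongr
  · exact (norm_nonneg _).trans hA
  · refine (norm_add_le _ _).trans ((add_le_add h1 h2).trans (le_of_eq ?_))
    ring

/-- If the rotational derivatives integrate to zero, an integral of cone waves is invariant under
rotation, hence equal to its value on the axis. -/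
lemma integral_coneWave_eq_axis {k r a : ℝ} {J : Set ℝ} (hJ : MeasurableSet J) {s q : ℝ → ℂ}
    (hs : ContinuousOn s J) (hq : ContinuousOn q J) {b b' : ℝ → ℝ} (hb : IntegrableOn b J)
    (hb' : IntegrableOn b' J)
    (hF : ∀ α ∈ Set.Ioo (-a) a, ∀ t ∈ J,
      ‖coneWave k (r * Real.cos α) (r * Real.sin α) (s t) (q t)‖ ≤ b t)
    (hD : ∀ α ∈ Set.Ioo (-a) a, ∀ t ∈ J,
      ‖coneWaveRot k (r * Real.cos α) (r * Real.sin α) (s t) (q t)‖ ≤ b' t)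
    (h0 : ∀ α ∈ Set.Ioo (-a) a,
      IntegrableOn (fun t => coneWaveRot k (r * Real.cos α) (r * Real.sin α) (s t) (q t)) J →
      ∫ t in J, coneWaveRot k (r * Real.cos α) (r * Real.sin α) (s t) (q t) = 0)
    {α : ℝ} (hα : α ∈ Set.Ioo (-a) a) :
    ∫ t in J, coneWave k (r * Real.cos α) (r * Real.sin α) (s t) (q t) =
      ∫ t in J, Complex.exp (Complex.I * k * s t * r) * (2 * Real.pi) := by
  have hb0 := continuous_besselInt 0
  have hb1 := continuous_besselInt 1
  have hm : ∀ α : ℝ, AEStronglyMeasurable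
      (fun t => coneWave k (r * Real.cos α) (r * Real.sin α) (s t) (q t)) (volume.restrict J) := by
    intro α
    refine ContinuousOn.aestronglyMeasurable ?_ hJ
    unfold coneWave
    exact ((by fun_prop : ContinuousOn (fun t => Complex.I * k * s t *
      ((r * Real.cos α : ℝ) : ℂ)) J).cexp).mul (hb0.comp_continuousOn (by fun_prop))
  have hm' : ∀ α : ℝ, AEStronglyMeasurable
      (fun t => coneWaveRot k (r * Real.cos α) (r * Real.sin α) (s t) (q t))
        (volume.restrict J) := by
    intro α
    refine ContinuousOn.aestronglyMeasurable ?_ hJ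
    unfold coneWaveRot
    have hw : ContinuousOn (fun t => k * q t * ((r * Real.sin α : ℝ) : ℂ)) J := by fun_prop
    have e0 := hb0.comp_continuousOn hw
    have e1 := hb1.comp_continuousOn hw
    exact ((by fun_prop : ContinuousOn (fun t => Complex.I * k * s t *
      ((r * Real.cos α : ℝ) : ℂ)) J).cexp).mul
      (((by fun_prop : ContinuousOn (fun t => -(Complex.I * k * s t *
        ((r * Real.sin α : ℝ) : ℂ))) J).mul e0).add
      ((by fun_prop : ContinuousOn (fun t => k * q t * ((r * Real.cos α : ℝ) : ℂ)) J).mul e1))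
  have hder : ∀ β ∈ Set.Ioo (-a) a, HasDerivAt
      (fun α => ∫ t in J, coneWave k (r * Real.cos α) (r * Real.sin α) (s t) (q t)) 0 β := by
    intro β hβ
    have h := hasDerivAt_integral_of_dominated_loc_of_deriv_le (μ := volume.restrict J)
      (F := fun α t => coneWave k (r * Real.cos α) (r * Real.sin α) (s t) (q t))
      (F' := fun α t => coneWaveRot k (r * Real.cos α) (r * Real.sin α) (s t) (q t))
      (bound := b') (x₀ := β) (isOpen_Ioo.mem_nhds hβ) (.of_forall hm)
      (Integrable.mono' hb (hm β) ((ae_restrict_iff' hJ).2 (.of_forall (hF β hβ)))) (hm' β)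
      ((ae_restrict_iff' hJ).2 (.of_forall fun t ht α hα => hD α hα t ht)) hb'
      (.of_forall fun t α _ => hasDerivAt_coneWave k r (s t) (q t) α)
    have h2 := h.2
    rwa [h0 β hβ h.1] at h2
  have ha : (0 : ℝ) ∈ Set.Ioo (-a) a := ⟨by linarith [hα.1, hα.2], by linarith [hα.1, hα.2]⟩
  have h := isOpen_Ioo.is_const_of_deriv_eq_zero isPreconnected_Ioo
    (fun β hβ => (hder β hβ).differentiableAt.differentiableWithinAt)
    (fun β hβ => (hder β hβ).deriv) hα ha
  rw [h]
  simp [coneWave, besselInt_zero_zero]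

/-- The average of plane waves over the unit sphere. -/
lemma integral_coneWave_sphere {k : ℝ} (hk : 0 < k) {z ρ : ℝ} (hr : (⟨z, ρ⟩ : ℂ) ≠ 0) :
    ∫ t in Set.Ioo (-1 : ℝ) 1, coneWave k z ρ t (√(1 - t ^ 2) : ℝ) =
      4 * Real.pi * Complex.sin (k * ‖(⟨z, ρ⟩ : ℂ)‖) / (k * ‖(⟨z, ρ⟩ : ℂ)‖) := by
  set ζ : ℂ := ⟨z, ρ⟩ with hζ
  set r := ‖ζ‖ with hrdef
  have hr0 : 0 < r := norm_pos_iff.2 hr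
  have hz : z = r * Real.cos ζ.arg := (Complex.norm_mul_cos_arg ζ).symm
  have hρ : ρ = r * Real.sin ζ.arg := (Complex.norm_mul_sin_arg ζ).symm
  have hexp : ∀ t z' : ℝ, ‖Complex.exp (Complex.I * k * t * z')‖ ≤ 1 := by
    intro t z'
    rw [Complex.norm_exp]
    simp
  have hB : ∀ t ρ' : ℝ, Real.exp |(k * ((√(1 - t ^ 2) : ℝ) : ℂ) * ρ').im| ≤ 1 := by
    intro t ρ'
    simp
  have hJb : ∀ c : ℝ, IntegrableOn (fun _ : ℝ => c) (Set.Ioo (-1 : ℝ) 1) := fun c =>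
    integrableOn_const (by simp)
  have hcq : Continuous fun t : ℝ => ((√(1 - t ^ 2) : ℝ) : ℂ) := by fun_prop
  have hmain := integral_coneWave_eq_axis (k := k) (r := r) (a := 4) (α := ζ.arg)
    (J := Set.Ioo (-1 : ℝ) 1) measurableSet_Ioo
    (s := fun t => (t : ℂ)) (q := fun t => ((√(1 - t ^ 2) : ℝ) : ℂ))
    (by fun_prop) hcq.continuousOn
    (hJb (1 * (2 * Real.pi * 1))) (hJb (1 * (2 * (|k| * 1 * r) * (2 * Real.pi * 1))))
    (fun α _ t _ => norm_coneWave_le (hexp _ _) (hB _ _))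
    (fun α _ t ht => norm_coneWaveRot_le (hexp _ _) (hB _ _)
      (by rw [Complex.norm_real, Real.norm_eq_abs, abs_le]; exact ⟨ht.1.le, ht.2.le⟩)
      (by
        rw [Complex.norm_real, Real.norm_eq_abs, abs_of_nonneg (Real.sqrt_nonneg _),
          Real.sqrt_le_one]
        nlinarith [sq_nonneg t])
      (by
        rw [abs_mul, abs_of_pos hr0]
        exact mul_le_of_le_one_right hr0.le (Real.abs_cos_le_one α))
      (by
        rw [abs_mul, abs_of_pos hr0]
        exact mul_le_of_le_one_right hr0.le (Real.abs_sin_le_one α)))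
    (by
      intro α _ hint
      have hcont : Continuous fun t : ℝ => ((√(1 - t ^ 2) : ℝ) : ℂ) *
          besselInt 1 (k * ((√(1 - t ^ 2) : ℝ) : ℂ) * ((r * Real.sin α : ℝ) : ℂ)) *
          Complex.exp (Complex.I * k * t * ((r * Real.cos α : ℝ) : ℂ)) :=
        (hcq.mul ((continuous_besselInt 1).comp (by fun_prop))).mul (by fun_prop)
      have h := intervalIntegral.integral_eq_sub_of_hasDeriv_right_of_le
        (a := -1) (b := 1) (by norm_num) hcont.continuousOn
        (fun t ht => (hasDerivAt_aperture k (r * Real.cos α) (r * Real.sin α) (c := 1)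
          (s := fun t => (t : ℂ)) (q := fun t => ((√(1 - t ^ 2) : ℝ) : ℂ))
          (q' := ((-(2 * t) / (2 * √(1 - t ^ 2)) : ℝ) : ℂ))
          Complex.ofRealCLM.hasDerivAt (by
            have hpos : 1 - t ^ 2 ≠ 0 := by nlinarith [ht.1, ht.2]
            have := ((hasDerivAt_pow 2 t).const_sub 1).sqrt hpos
            simpa using this.ofReal_comp) (by
            have hpos : 0 < 1 - t ^ 2 := by nlinarith [ht.1, ht.2]
            have := Real.sqrt_pos.2 hpos
            rw [← Complex.ofReal_mul]
            rw [show √(1 - t ^ 2) * (-(2 * t) / (2 * √(1 - t ^ 2))) = -t by field_simp]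
            simp)).hasDerivWithinAt)
        (by
          rw [intervalIntegrable_iff_integrableOn_Ioo_of_le (by norm_num)]
          exact hint.const_mul _)
      rw [intervalIntegral.integral_of_le (by norm_num), integral_Ioc_eq_integral_Ioo,
        integral_const_mul] at h
      simpa using h)
    ⟨by linarith [Complex.neg_pi_lt_arg ζ, Real.pi_lt_four],
      by linarith [Complex.arg_le_pi ζ, Real.pi_lt_four]⟩
  rw [← hz, ← hρ] at hmain
  rw [hmain, ← integral_Ioc_eq_integral_Ioo, ← intervalIntegral.integral_of_le (by norm_num),
    intervalIntegral.integral_mul_const]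
  have hne : (Complex.I * k * r : ℂ) ≠ 0 := by
    simp [hk.ne', hr0.ne']
  have h3 := integral_exp_mul_complex (a := -1) (b := 1) hne
  have h4 : ∀ t : ℝ, Complex.exp (Complex.I * k * t * r) = Complex.exp (Complex.I * k * r * t) := by
    intro t; ring_nf
  simp only [h4, h3]
  rw [Complex.sin]
  have hk' : (k : ℂ) ≠ 0 := by exact_mod_cast hk.ne'
  have hr' : (r : ℂ) ≠ 0 := by exact_mod_cast hr0.ne'
  have hI := Complex.I_sq
  push_cast
  rw [show -(k * r : ℂ) * Complex.I = Complex.I * k * r * -1 by ring,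
    show (k * r : ℂ) * Complex.I = Complex.I * k * r * 1 by ring]
  field_simp
  rw [hI]
  ring

/-- The sine of the complex aperture angle whose cosine is `1 + i t`. -/
def aperture (t : ℝ) : ℂ := ((t : ℂ) ^ 2 - 2 * Complex.I * t) ^ ((2 : ℕ) : ℂ)⁻¹

lemma aperture_sq (t : ℝ) : aperture t ^ 2 = (t : ℂ) ^ 2 - 2 * Complex.I * t :=
  Complex.cpow_nat_inv_pow _ two_ne_zero

lemma aperture_slit {t : ℝ} (ht : 0 < t) :
    (t : ℂ) ^ 2 - 2 * Complex.I * t ∈ Complex.slitPlane := by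
  left
  simp [pow_two]
  positivity

lemma hasDerivAt_aperture_sq (t : ℝ) :
    HasDerivAt (fun t : ℝ => (t : ℂ) ^ 2 - 2 * Complex.I * t) (2 * (t : ℂ) - 2 * Complex.I) t := by
  have h0 : HasDerivAt (fun t : ℝ => (t : ℂ)) 1 t := Complex.ofRealCLM.hasDerivAt
  convert! (h0.pow 2).sub (h0.const_mul (2 * Complex.I)) using 1
  simp

lemma differentiableAt_aperture {t : ℝ} (ht : 0 < t) : DifferentiableAt ℝ aperture t := by
  have h : HasDerivAt (fun w : ℂ => w ^ ((2 : ℕ) : ℂ)⁻¹) _ ((t : ℂ) ^ 2 - 2 * Complex.I * t) :=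
    (hasDerivAt_id _).cpow_const (aperture_slit ht)
  exact (HasDerivAt.comp t h (hasDerivAt_aperture_sq t)).differentiableAt

lemma hasDerivAt_aperture_mul {t : ℝ} (ht : 0 < t) :
    aperture t * deriv aperture t = -((1 + Complex.I * t) * Complex.I) := by
  have h1 := (differentiableAt_aperture ht).hasDerivAt.pow 2
  rw [show (aperture ^ 2) = fun t : ℝ => (t : ℂ) ^ 2 - 2 * Complex.I * t from
    funext aperture_sq] at h1
  have h2 := h1.unique (hasDerivAt_aperture_sq t)
  have hI := Complex.I_sq
  simp at h2
  linear_combination h2 / 2 + t * hI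

lemma norm_aperture_sq (t : ℝ) : ‖aperture t‖ ^ 2 ≤ t ^ 2 + 2 * |t| := by
  rw [← norm_pow, aperture_sq]
  refine (norm_sub_le _ _).trans ?_
  simp

lemma norm_aperture_le {t : ℝ} (ht : 0 < t) : ‖aperture t‖ ≤ 1 + t := by
  have h := norm_aperture_sq t
  rw [abs_of_pos ht] at h
  nlinarith [norm_nonneg (aperture t)]

lemma abs_im_aperture_le (t : ℝ) : |(aperture t).im| ≤ 1 := by
  have h := aperture_sq t
  have h1 := congrArg Complex.re h
  have h2 := congrArg Complex.im h
  simp [pow_two] at h1 h2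
  set a := (aperture t).re
  set b := (aperture t).im
  have h3 : a * b = -t := by linarith
  have h4 : b ^ 2 * a ^ 2 = t ^ 2 := by
    rw [← mul_pow, mul_comm, h3]; ring
  have h5 : t ^ 2 ≤ a ^ 2 := by nlinarith [sq_nonneg b]
  rw [← sq_le_one_iff_abs_le_one]
  by_contra! hb
  nlinarith [sq_nonneg a]

lemma continuousOn_aperture : ContinuousOn aperture (Set.Ioi 0) :=
  fun t (ht : 0 < t) => (differentiableAt_aperture ht).continuousAt.continuousWithinAt

lemma continuousWithinAt_aperture : ContinuousWithinAt aperture (Set.Ici 0) 0 := by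
  have h0 : aperture 0 = 0 := by
    have := aperture_sq 0
    simpa using this
  rw [ContinuousWithinAt, h0, tendsto_zero_iff_norm_tendsto_zero]
  have h1 : Tendsto (fun t : ℝ => √(t ^ 2 + 2 * |t|)) (𝓝[Set.Ici 0] 0) (𝓝 0) := by
    have : Continuous fun t : ℝ => √(t ^ 2 + 2 * |t|) := by fun_prop
    have h := this.tendsto 0
    simp only [abs_zero, mul_zero, add_zero, ne_eq, OfNat.ofNat_ne_zero, not_false_eq_true,
      zero_pow, Real.sqrt_zero] at h
    exact h.mono_left nhdsWithin_le_nhds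
  exact squeeze_zero (fun _ => norm_nonneg _)
    (fun t => Real.le_sqrt_of_sq_le (norm_aperture_sq t)) h1

/-- Weyl's expansion of the outgoing spherical wave into plane waves, written along the contour of
directions `1 + i t`. -/
lemma integral_coneWave_weyl {k : ℝ} (hk : 0 < k) {z ρ : ℝ} (hz0 : 0 < z) :
    ∫ t in Set.Ioi (0 : ℝ), coneWave k z ρ (1 + Complex.I * t) (aperture t) =
      2 * Real.pi * Complex.exp (Complex.I * k * ‖(⟨z, ρ⟩ : ℂ)‖) / (k * ‖(⟨z, ρ⟩ : ℂ)‖) := by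
  set ζ : ℂ := ⟨z, ρ⟩ with hζ
  set r := ‖ζ‖ with hrdef
  have hr : ζ ≠ 0 := fun h => hz0.ne' (congrArg Complex.re h)
  have hr0 : 0 < r := norm_pos_iff.2 hr
  have hz : z = r * Real.cos ζ.arg := (Complex.norm_mul_cos_arg ζ).symm
  have hρ : ρ = r * Real.sin ζ.arg := (Complex.norm_mul_sin_arg ζ).symm
  obtain ⟨a, ha1, ha2⟩ := exists_between (Complex.abs_arg_lt_pi_div_two_iff (z := ζ).2 (.inl hz0))
  have ha0 : 0 < a := (abs_nonneg _).trans_lt ha1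
  set δ := r * Real.cos a
  have hδ : 0 < δ := mul_pos hr0 (Real.cos_pos_of_mem_Ioo ⟨by linarith, ha2⟩)
  have hcos : ∀ α ∈ Set.Ioo (-a) a, δ ≤ r * Real.cos α := by
    intro α hα
    refine mul_le_mul_of_nonneg_left ?_ hr0.le
    rw [← Real.cos_abs α]
    exact Real.cos_le_cos_of_nonneg_of_le_pi (abs_nonneg _) (by linarith [Real.pi_pos])
      (abs_lt.2 hα).le
  have hexp : ∀ α ∈ Set.Ioo (-a) a, ∀ t ∈ Set.Ioi (0 : ℝ),
      ‖Complex.exp (Complex.I * k * (1 + Complex.I * t) * ((r * Real.cos α : ℝ) : ℂ))‖ ≤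
        Real.exp (-(k * δ) * t) := by
    intro α hα t ht
    rw [Complex.norm_exp]
    apply Real.exp_le_exp.2
    have : (Complex.I * k * (1 + Complex.I * t) * ((r * Real.cos α : ℝ) : ℂ)).re =
        -(k * t * (r * Real.cos α)) := by
      simp [Complex.mul_re, Complex.mul_im, -Complex.ofReal_mul]
    rw [this]
    have h1 := mul_le_mul_of_nonneg_left (hcos α hα) (mul_pos hk ht).le
    linarith
  have hB : ∀ α : ℝ, ∀ t ∈ Set.Ioi (0 : ℝ),
      Real.exp |(k * aperture t * ((r * Real.sin α : ℝ) : ℂ)).im| ≤ Real.exp (k * r) := by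
    intro α t ht
    apply Real.exp_le_exp.2
    have h1 : (k * aperture t * ((r * Real.sin α : ℝ) : ℂ)).im =
        k * (aperture t).im * (r * Real.sin α) := by
      simp [Complex.mul_re, Complex.mul_im, -Complex.ofReal_mul]
    rw [h1, abs_mul, abs_mul, abs_mul, abs_of_pos hk, abs_of_pos hr0]
    calc _ ≤ k * 1 * (r * 1) := by
          gcongr
          · exact abs_im_aperture_le t
          · exact Real.abs_sin_le_one α
      _ = _ := by ring
  have hrot : ∀ α ∈ Set.Ioo (-a) a, ∀ t ∈ Set.Ioi (0 : ℝ),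
      ‖coneWaveRot k (r * Real.cos α) (r * Real.sin α) (1 + Complex.I * t) (aperture t)‖ ≤
      Real.exp (-(k * δ) * t) * (2 * (|k| * (1 + t) * r) * (2 * Real.pi * Real.exp (k * r))) := by
    intro α hα t ht
    refine norm_coneWaveRot_le (hexp α hα t ht) (hB α t ht) ?_ (norm_aperture_le ht) ?_ ?_
    · refine (norm_add_le _ _).trans ?_
      rw [norm_mul, Complex.norm_real, Real.norm_of_nonneg (le_of_lt ht)]
      simp
    · rw [abs_mul, abs_of_pos hr0]
      exact mul_le_of_le_one_right hr0.le (Real.abs_cos_le_one α)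
    · rw [abs_mul, abs_of_pos hr0]
      exact mul_le_of_le_one_right hr0.le (Real.abs_sin_le_one α)
  have hkδ : 0 < k * δ := mul_pos hk hδ
  have hint0 : IntegrableOn (fun t : ℝ => Real.exp (-(k * δ) * t)) (Set.Ioi 0) :=
    integrableOn_exp_mul_Ioi (by linarith) 0
  have hint1 : IntegrableOn (fun t : ℝ => t * Real.exp (-(k * δ) * t)) (Set.Ioi 0) := by
    have := integrableOn_rpow_mul_exp_neg_mul_rpow (p := 1) (s := 1) (b := k * δ)
      (by norm_num) one_pos hkδ
    simpa using this
  have hmain := integral_coneWave_eq_axis (k := k) (r := r) (a := a) (α := ζ.arg)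
    (J := Set.Ioi (0 : ℝ)) measurableSet_Ioi
    (s := fun t => 1 + Complex.I * t) (q := aperture)
    (by fun_prop) continuousOn_aperture
    (hint0.mul_const (2 * Real.pi * Real.exp (k * r)))
    (b' := fun t => Real.exp (-(k * δ) * t) *
      (2 * (|k| * (1 + t) * r) * (2 * Real.pi * Real.exp (k * r))))
    (by
      refine (((Integrable.add hint0 hint1).mul_const
        (2 * (|k| * r) * (2 * Real.pi * Real.exp (k * r))))).congr (.of_forall fun t => ?_)
      simp only [Pi.add_apply]
      ring)
    (fun α hα t ht => norm_coneWave_le (hexp α hα t ht) (hB α t ht))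
    hrot
    (by
      intro α hα hint
      set H : ℝ → ℂ := fun t => aperture t *
          besselInt 1 (k * aperture t * ((r * Real.sin α : ℝ) : ℂ)) *
          Complex.exp (Complex.I * k * (1 + Complex.I * t) * ((r * Real.cos α : ℝ) : ℂ)) with hH
      have hcont : ContinuousWithinAt H (Set.Ici 0) 0 := by
        have h0 := continuousWithinAt_aperture
        refine (h0.mul ?_).mul (by fun_prop)
        exact (continuous_besselInt 1).continuousAt.comp_continuousWithinAt (by fun_prop)
      have hderiv : ∀ t ∈ Set.Ioi (0 : ℝ), HasDerivAt H (Complex.I * Complex.I *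
          coneWaveRot k (r * Real.cos α) (r * Real.sin α) (1 + Complex.I * t) (aperture t)) t := by
        intro t ht
        refine hasDerivAt_aperture k (r * Real.cos α) (r * Real.sin α)
          (s := fun t => 1 + Complex.I * t) ?_ (differentiableAt_aperture ht).hasDerivAt
          (hasDerivAt_aperture_mul ht)
        have h0 : HasDerivAt (fun t : ℝ => (t : ℂ)) 1 t := Complex.ofRealCLM.hasDerivAt
        simpa using (h0.const_mul Complex.I).const_add 1
      have hlim : Tendsto H atTop (𝓝 0) := by
        rw [tendsto_zero_iff_norm_tendsto_zero]
        have hb : Tendsto (fun t : ℝ => (2 * Real.pi * Real.exp (k * r)) *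
            (Real.exp (-(k * δ) * t) + t * Real.exp (-(k * δ) * t))) atTop (𝓝 0) := by
          have e0 := tendsto_rpow_mul_exp_neg_mul_atTop_nhds_zero 0 (k * δ) hkδ
          have e1 := tendsto_rpow_mul_exp_neg_mul_atTop_nhds_zero 1 (k * δ) hkδ
          simpa using (e0.add e1).const_mul (2 * Real.pi * Real.exp (k * r))
        refine squeeze_zero' (.of_forall fun _ => norm_nonneg _) ?_ hb
        filter_upwards [Ioi_mem_atTop 0] with t ht
        rw [hH, norm_mul, norm_mul]
        calc _ ≤ (1 + t) * (2 * Real.pi * Real.exp (k * r)) * Real.exp (-(k * δ) * t) := by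
              have ht' : 0 < t := ht
              gcongr
              · exact norm_aperture_le ht
              · exact (norm_besselInt_le _ _).trans
                  (mul_le_mul_of_nonneg_left (hB α t ht) (by positivity))
              · exact hexp α hα t ht
          _ = _ := by ring
      have h := integral_Ioi_of_hasDerivAt_of_tendsto hcont hderiv (hint.const_mul _) hlim
      have hH0 : H 0 = 0 := by
        have h0 : aperture 0 = 0 := by
          have := aperture_sq 0
          simpa using this
        simp [hH, h0]
      rw [integral_const_mul, hH0] at h
      simpa using h)
    (abs_lt.1 ha1)
  rw [← hz, ← hρ] at hmain
  rw [hmain, integral_mul_const]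
  have h4 : ∀ t : ℝ, Complex.exp (Complex.I * k * (1 + Complex.I * t) * r) =
      Complex.exp (Complex.I * k * r) * Complex.exp (((-(k * r) : ℝ) : ℂ) * t) := by
    intro t
    rw [← Complex.exp_add]
    congr 1
    have hI := Complex.I_sq
    push_cast
    linear_combination (k * t * r : ℂ) * hI
  simp only [h4]
  rw [integral_const_mul, integral_exp_mul_complex_Ioi (by simp; positivity)]
  have hk' : (k : ℂ) ≠ 0 := by exact_mod_cast hk.ne'
  have hr' : (r : ℂ) ≠ 0 := by exact_mod_cast hr0.ne'
  push_cast
  simp only [mul_zero, Complex.exp_zero]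
  field_simp


/-! ### Laplace transforms of bounded functions with bounded support -/

/-- A bounded measurable function supported in a ball around the origin. -/
structure BddSupp (f : E3 → ℂ) (R B : ℝ) : Prop where
  measurable : Measurable f
  bound : ∀ y, ‖f y‖ ≤ B
  supp : ∀ y, R < ‖y‖ → f y = 0

/-- The bilinear pairing of a complex frequency with a point. -/
def pairing (c : Fin 3 → ℂ) (y : E3) : ℂ := c 0 * y 0 + c 1 * y 1 + c 2 * y 2

/-- The two-sided Laplace transform. -/
def laplaceT (f : E3 → ℂ) (c : Fin 3 → ℂ) : ℂ := ∫ y, Complex.exp (pairing c y) * f y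

lemma abs_coord_le (y : E3) (i : Fin 3) : |y i| ≤ ‖y‖ := by
  simpa using PiLp.norm_apply_le y i

@[fun_prop]
lemma continuous_pairing_right (c : Fin 3 → ℂ) : Continuous (pairing c) := by
  unfold pairing; fun_prop

lemma norm_pairing_le (c : Fin 3 → ℂ) (y : E3) : ‖pairing c y‖ ≤ 3 * ‖c‖ * ‖y‖ := by
  have h : ∀ i, ‖c i * (y i : ℂ)‖ ≤ ‖c‖ * ‖y‖ := fun i => by
    rw [norm_mul, Complex.norm_real]
    exact mul_le_mul (norm_le_pi_norm c i) (abs_coord_le y i) (norm_nonneg _) (norm_nonneg _)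
  calc _ ≤ ‖c 0 * (y 0 : ℂ)‖ + ‖c 1 * (y 1 : ℂ)‖ + ‖c 2 * (y 2 : ℂ)‖ := norm_add₃_le
    _ ≤ _ := by linarith [h 0, h 1, h 2]

lemma norm_exp_le_of_norm_le {w : ℂ} {r : ℝ} (h : ‖w‖ ≤ r) : ‖Complex.exp w‖ ≤ Real.exp r := by
  rw [Complex.norm_exp]
  exact Real.exp_le_exp.2 ((Complex.re_le_norm w).trans h)

namespace BddSupp

variable {f : E3 → ℂ} {R B : ℝ}

lemma eq_indicator (hf : BddSupp f R B) : (Metric.closedBall 0 R).indicator f = f := by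
  rw [Set.indicator_eq_self]
  intro y hy
  by_contra h
  exact hy (hf.supp y (by simpa using h))

lemma integrable (hf : BddSupp f R B) : Integrable f := by
  rw [← hf.eq_indicator, integrable_indicator_iff Metric.isClosed_closedBall.measurableSet]
  exact Measure.integrableOn_of_bounded (M := B)
    (isCompact_closedBall 0 R).measure_lt_top.ne hf.measurable.aestronglyMeasurable
    (.of_forall hf.bound)

lemma integrable_mul (hf : BddSupp f R B) {g : E3 → ℂ}
    (hg : IntegrableOn g (Metric.closedBall 0 R)) : Integrable (fun y => g y * f y) := by
  have h : (fun y => g y * f y) =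
      (Metric.closedBall 0 R).indicator (fun y => g y * f y) := by
    conv_lhs => rw [← hf.eq_indicator]
    funext y
    by_cases hy : y ∈ Metric.closedBall (0 : E3) R <;> simp [hy]
  rw [h, integrable_indicator_iff Metric.isClosed_closedBall.measurableSet]
  exact Integrable.mul_bdd (c := B) hg hf.measurable.aestronglyMeasurable (.of_forall hf.bound)

lemma integrable_continuous_mul (hf : BddSupp f R B) {g : E3 → ℂ} (hg : Continuous g) :
    Integrable (fun y => g y * f y) :=
  hf.integrable_mul (hg.continuousOn.integrableOn_compact (isCompact_closedBall 0 R))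

lemma nonneg (hf : BddSupp f R B) : 0 ≤ B := (norm_nonneg _).trans (hf.bound 0)

lemma norm_mul_le {g : ℂ} {M : ℝ} (hf : BddSupp f R B) (y : E3)
    (hg : ‖y‖ ≤ R → ‖g‖ ≤ M) : ‖g * f y‖ ≤ M * ‖f y‖ := by
  rw [norm_mul]
  by_cases hy : ‖y‖ ≤ R
  · gcongr
    exact hg hy
  · simp [hf.supp y (not_le.1 hy)]

/-- Laplace transforms of boundedly supported functions are entire. -/
lemma differentiable_laplaceT (hf : BddSupp f R B) : Differentiable ℂ (laplaceT f) := by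
  intro c₀
  set P : Fin 3 → (Fin 3 → ℂ) →L[ℂ] ℂ := fun i => ContinuousLinearMap.proj i with hP
  set L : E3 → (Fin 3 → ℂ) →L[ℂ] ℂ := fun y =>
    (y 0 : ℂ) • P 0 + (y 1 : ℂ) • P 1 + (y 2 : ℂ) • P 2 with hL
  have hLc : Continuous L := by
    have : ∀ i, Continuous fun y : E3 => (y i : ℂ) := fun i => by fun_prop
    exact (((this 0).smul continuous_const).add ((this 1).smul continuous_const)).add
      ((this 2).smul continuous_const)
  have hLp : ∀ c y, L y c = pairing c y := by
    intro c y
    simp [hL, hP, pairing, mul_comm]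
  have hLn : ∀ y, ‖L y‖ ≤ 3 * ‖y‖ := by
    intro y
    refine ContinuousLinearMap.opNorm_le_bound _ (by positivity) fun c => ?_
    rw [hLp]
    linarith [norm_pairing_le c y]
  have hd : ∀ c y, HasFDerivAt (fun c => Complex.exp (pairing c y) * f y)
      ((Complex.exp (pairing c y) * f y) • L y) c := by
    intro c y
    have h : HasFDerivAt (fun c => pairing c y) (L y) c := by
      have h : (fun c => pairing c y) = L y := funext fun c => (hLp c y).symm
      rw [h]
      exact (L y).hasFDerivAt
    convert! h.cexp.mul_const (f y) using 1
    ext v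
    simp
    ring
  set M := Real.exp (3 * (‖c₀‖ + 1) * |R|)
  refine (hasFDerivAt_integral_of_dominated_of_fderiv_le (μ := volume)
    (s := Metric.ball c₀ 1) (bound := fun y => 3 * |R| * (M * ‖f y‖))
    (F := fun c y => Complex.exp (pairing c y) * f y)
    (F' := fun c y => (Complex.exp (pairing c y) * f y) • L y)
    (Metric.ball_mem_nhds c₀ one_pos) ?_ ?_ ?_ ?_ ?_ ?_).differentiableAt
  · exact .of_forall fun c => (hf.integrable_continuous_mul (by fun_prop)).aestronglyMeasurable
  · exact hf.integrable_continuous_mul (by fun_prop)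
  · exact (hf.integrable_continuous_mul (by fun_prop)).aestronglyMeasurable.smul
      hLc.aestronglyMeasurable
  · refine .of_forall fun y c hc => ?_
    rw [norm_smul]
    by_cases hy : ‖y‖ ≤ R
    · have hR : ‖y‖ ≤ |R| := hy.trans (le_abs_self R)
      have hc' : ‖c‖ ≤ ‖c₀‖ + 1 := by
        have h1 : ‖c - c₀‖ < 1 := by simpa [dist_eq_norm] using hc
        have h2 := norm_sub_norm_le c c₀
        linarith
      rw [mul_comm]
      gcongr
      · exact (hLn y).trans (by gcongr)
      · refine hf.norm_mul_le y fun _ => norm_exp_le_of_norm_le ?_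
        refine (norm_pairing_le c y).trans ?_
        gcongr
    · simp [hf.supp y (not_le.1 hy)]
  · exact (hf.integrable.norm.const_mul M).const_mul _
  · exact .of_forall fun y c _ => hd c y

end BddSupp

/-- The direction with aperture cosine `s`, aperture sine `q` and azimuth `φ`. -/
def direction (s q : ℂ) (φ : ℝ) : Fin 3 → ℂ := ![s, q * Real.cos φ, q * Real.sin φ]

lemma pairing_direction (s q : ℂ) (φ : ℝ) (y : E3) :
    pairing (direction s q φ) y = s * y 0 + q * (y 1 * Real.cos φ + y 2 * Real.sin φ) := by
  simp [pairing, direction]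
  ring

/-- The distance of a point from the first axis. -/
def axisDist (w : E3) : ℝ := ‖(⟨w 1, w 2⟩ : ℂ)‖

lemma norm_axisDist (w : E3) : ‖(⟨w 0, axisDist w⟩ : ℂ)‖ = ‖w‖ := by
  rw [EuclideanSpace.norm_eq, Fin.sum_univ_three, Complex.norm_def, Complex.normSq_mk, axisDist]
  congr 1
  simp only [Real.norm_eq_abs, sq_abs]
  rw [← pow_two ‖_‖, ← Complex.normSq_eq_norm_sq, Complex.normSq_mk]
  ring

lemma integral_planeWave_circle (k : ℝ) (s q : ℂ) (w : E3) :
    ∫ φ in (0 : ℝ)..(2 * Real.pi),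
      Complex.exp (Complex.I * k * pairing (direction s q φ) w) =
      coneWave k (w 0) (axisDist w) s q := by
  have h : ∀ φ : ℝ, Complex.exp (Complex.I * k * pairing (direction s q φ) w) =
      Complex.exp (Complex.I * k * s * w 0) *
        Complex.exp (Complex.I * (k * q) * ((w 1 : ℝ) * Real.cos φ + (w 2 : ℝ) * Real.sin φ)) := by
    intro φ
    rw [← Complex.exp_add, pairing_direction]
    congr 1
    ring
  simp only [h, coneWave, axisDist]
  rw [intervalIntegral.integral_const_mul, integral_exp_circle]

/-! ### Local integrability of the Green's function -/

lemma integrableOn_inv_norm (R : ℝ) :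
    IntegrableOn (fun w : E3 => ‖w‖⁻¹) (Metric.closedBall 0 R) := by
  have h : (Metric.closedBall (0 : E3) R).indicator (fun w : E3 => ‖w‖⁻¹) =
      fun w => (Set.Iic R).indicator (fun r : ℝ => r⁻¹) ‖w‖ := by
    funext w
    by_cases hw : ‖w‖ ≤ R <;> simp [hw]
  rw [← integrable_indicator_iff Metric.isClosed_closedBall.measurableSet, h,
    integrable_fun_norm_addHaar]
  have h2 : Set.EqOn ((Set.Iic R).indicator fun r : ℝ => r)
      (fun y => y ^ (Module.finrank ℝ E3 - 1) • (Set.Iic R).indicator (fun r : ℝ => r⁻¹) y)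
      (Set.Ioi 0) := by
    intro y hy
    have hy0 : y ≠ 0 := (Set.mem_Ioi.1 hy).ne'
    by_cases hyR : y ≤ R
    · simp [hyR]
      field_simp
    · simp [hyR]
  refine IntegrableOn.congr_fun ?_ h2 measurableSet_Ioi
  rw [IntegrableOn, integrable_indicator_iff measurableSet_Iic, IntegrableOn,
    Measure.restrict_restrict measurableSet_Iic]
  exact (continuous_id.integrableOn_Icc (a := 0) (b := R)).mono_set
    fun y hy => ⟨(Set.mem_Ioi.1 hy.2).le, hy.1⟩

lemma greens_eq (k : ℝ) (x y : E3) : greens k x y = greens k (x - y) 0 := by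
  simp [greens]

lemma greens_comm (k : ℝ) (x y : E3) : greens k x y = greens k y x := by
  simp [greens, norm_sub_rev x y]

lemma norm_greens (k : ℝ) (x y : E3) : ‖greens k x y‖ = (4 * Real.pi)⁻¹ * ‖x - y‖⁻¹ := by
  have : Complex.I * (k : ℂ) * (‖x - y‖ : ℂ) = ((k * ‖x - y‖ : ℝ) : ℂ) * Complex.I := by
    push_cast; ring
  rw [greens, norm_div, this, Complex.norm_exp_ofReal_mul_I, Complex.norm_real,
    Real.norm_of_nonneg (by positivity), one_div, mul_inv]

lemma measurable_greens (k : ℝ) : Measurable fun w : E3 × E3 => greens k w.1 w.2 := by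
  unfold greens
  fun_prop

lemma integrableOn_greens_zero (k R : ℝ) :
    IntegrableOn (fun w : E3 => greens k w 0) (Metric.closedBall 0 R) := by
  refine ((integrableOn_inv_norm R).const_mul (4 * Real.pi)⁻¹).mono'
    ((measurable_greens k).comp
      (by fun_prop : Measurable fun w : E3 => (w, (0 : E3)))).aestronglyMeasurable
    (.of_forall fun w => ?_)
  simp [norm_greens]

lemma integrableOn_greens (k R : ℝ) (x : E3) :
    IntegrableOn (fun y : E3 => greens k x y) (Metric.closedBall 0 R) := by
  have h := (integrable_indicator_iff Metric.isClosed_closedBall.measurableSet).2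
    (integrableOn_greens_zero k (‖x‖ + R))
  refine IntegrableOn.congr_fun (h.comp_sub_left x).integrableOn (fun y hy => ?_)
    Metric.isClosed_closedBall.measurableSet
  have hy' : ‖x - y‖ ≤ ‖x‖ + R := by
    have := norm_sub_le x y
    have : ‖y‖ ≤ R := by simpa using hy
    linarith
  rw [Set.indicator_of_mem (by simpa using hy'), ← greens_eq]

/-! ### The far field of a dissipative source vanishes -/

lemma pairing_smul (a : ℂ) (c : Fin 3 → ℂ) (y : E3) : pairing (a • c) y = a * pairing c y := by
  simp [pairing]
  ring

/-- A boundedly supported source `f` radiating a field `-u` to which it only loses energy. -/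
structure DissipativeSource (k : ℝ) (f u : E3 → ℂ) (R B : ℝ) : Prop extends BddSupp f R B where
  field : ∀ x, u x = -∫ y, greens k x y * f y
  dissipative : ∀ x, 0 ≤ (starRingEnd ℂ (f x) * u x).im

/-- The real unit direction with aperture cosine `ω.1` and azimuth `ω.2`. -/
def realDirection (ω : ℝ × ℝ) : Fin 3 → ℂ := direction ω.1 (√(1 - ω.1 ^ 2) : ℝ) ω.2

/-- The parameter domain of `realDirection`. -/
def angles : Set (ℝ × ℝ) := Set.Ioo (-1) 1 ×ˢ Set.Ioo 0 (2 * Real.pi)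

lemma isOpen_angles : IsOpen angles := isOpen_Ioo.prod isOpen_Ioo

instance : IsFiniteMeasure ((volume : Measure (ℝ × ℝ)).restrict angles) := by
  rw [angles, Measure.volume_eq_prod, ← Measure.prod_restrict]
  infer_instance

lemma continuous_realDirection : Continuous realDirection := by
  refine continuous_pi fun i => ?_
  fin_cases i <;> simp [realDirection, direction] <;> fun_prop

lemma pairing_realDirection (ω : ℝ × ℝ) (y : E3) :
    pairing (realDirection ω) y = ((ω.1 * y 0 + √(1 - ω.1 ^ 2) *
      (y 1 * Real.cos ω.2 + y 2 * Real.sin ω.2) : ℝ) : ℂ) := by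
  rw [realDirection, pairing_direction]
  push_cast
  rfl

lemma pairing_sub (c : Fin 3 → ℂ) (x y : E3) : pairing c (x - y) = pairing c x - pairing c y := by
  simp [pairing]
  ring

lemma norm_exp_pairing_realDirection (k : ℝ) (ω : ℝ × ℝ) (y : E3) :
    ‖Complex.exp (Complex.I * k * pairing (realDirection ω) y)‖ = 1 := by
  rw [pairing_realDirection, mul_assoc, ← Complex.ofReal_mul, mul_comm,
    Complex.norm_exp_ofReal_mul_I]

lemma continuous_planeWave (k : ℝ) : Continuous fun z : E3 × (ℝ × ℝ) =>
    Complex.exp (Complex.I * k * pairing (realDirection z.2) z.1) := by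
  simp only [pairing_realDirection]
  fun_prop

lemma integral_planeWave_angles {k : ℝ} (hk : 0 < k) {w : E3} (hw : w ≠ 0) :
    ∫ ω in angles, Complex.exp (Complex.I * k * pairing (realDirection ω) w) =
      4 * Real.pi * Complex.sin (k * ‖w‖) / (k * ‖w‖) := by
  have hint : IntegrableOn (fun ω => Complex.exp (Complex.I * k * pairing (realDirection ω) w))
      angles := by
    refine Integrable.of_bound (C := 1) ?_ (.of_forall fun ω => ?_)
    · exact ((continuous_planeWave k).comp (by fun_prop : Continuous fun ω : ℝ × ℝ => (w, ω)))
        |>.aestronglyMeasurable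
    · exact (norm_exp_pairing_realDirection k ω w).le
  rw [angles, Measure.volume_eq_prod] at *
  rw [setIntegral_prod _ hint]
  have hw' : (⟨w 0, axisDist w⟩ : ℂ) ≠ 0 := by
    rw [← norm_ne_zero_iff, norm_axisDist]
    exact norm_ne_zero_iff.2 hw
  rw [← norm_axisDist w, ← integral_coneWave_sphere hk hw']
  refine setIntegral_congr_fun measurableSet_Ioo fun s _ => ?_
  simp only
  rw [← integral_planeWave_circle, intervalIntegral.integral_of_le (by positivity),
    integral_Ioc_eq_integral_Ioo]
  rfl

lemma greens_sub_conj {k : ℝ} (hk : 0 < k) {x y : E3} (hxy : x ≠ y) :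
    greens k x y - starRingEnd ℂ (greens k x y) = Complex.I * k / (8 * Real.pi ^ 2) *
      ∫ ω in angles, Complex.exp (Complex.I * k * pairing (realDirection ω) (x - y)) := by
  have hr : ((‖x - y‖ : ℝ) : ℂ) ≠ 0 := by simpa [sub_eq_zero] using hxy
  have hπ : (Real.pi : ℂ) ≠ 0 := by simp [Real.pi_ne_zero]
  have hk' : (k : ℂ) ≠ 0 := by simp [hk.ne']
  rw [integral_planeWave_angles hk (sub_ne_zero.2 hxy), greens, map_div₀, Complex.conj_ofReal,
    ← Complex.exp_conj, Complex.sin]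
  simp only [map_mul, Complex.conj_I, Complex.conj_ofReal]
  have e1 : Complex.I * (k : ℂ) * (‖x - y‖ : ℝ) = (k : ℂ) * (‖x - y‖ : ℝ) * Complex.I := by ring
  have e2 : -Complex.I * (k : ℂ) * (‖x - y‖ : ℝ) = -((k : ℂ) * (‖x - y‖ : ℝ)) * Complex.I := by
    ring
  rw [e1, e2]
  push_cast
  field_simp
  ring_nf
  rw [Complex.I_sq]
  ring

namespace BddSupp

variable {f g : E3 → ℂ} {R B C : ℝ}

lemma integrable_greens_mul (hf : BddSupp f R B) (hg : BddSupp g R C) (k : ℝ) :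
    Integrable fun z : E3 × E3 => greens k z.1 z.2 * (g z.1 * f z.2) := by
  have h := Integrable.convolution_integrand (ContinuousLinearMap.mul ℂ ℂ) (μ := volume)
    (ν := volume) hf.integrable
    ((integrable_indicator_iff Metric.isClosed_closedBall.measurableSet).2
      (integrableOn_greens_zero k (2 * R)))
  have h2 := h.mul_bdd (c := C) (g := fun z : E3 × E3 => g z.1)
    (hg.measurable.comp measurable_fst).aestronglyMeasurable (.of_forall fun z => hg.bound _)
  rw [Measure.volume_eq_prod]
  refine h2.congr (.of_forall fun z => ?_)
  simp only [ContinuousLinearMap.mul_apply']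
  by_cases h1 : R < ‖z.1‖
  · simp [hg.supp _ h1]
  by_cases h2 : R < ‖z.2‖
  · simp [hf.supp _ h2]
  have : ‖z.1 - z.2‖ ≤ 2 * R := by
    have := norm_sub_le z.1 z.2
    linarith
  rw [Set.indicator_of_mem (by simpa using this), ← greens_eq]
  ring

lemma conj (hf : BddSupp f R B) : BddSupp (fun y => starRingEnd ℂ (f y)) R B where
  measurable := Complex.continuous_conj.measurable.comp hf.measurable
  bound y := by simpa using hf.bound y
  supp y hy := by simp [hf.supp y hy]

end BddSupp

lemma ae_fst_ne_snd : ∀ᵐ z : E3 × E3, z.1 ≠ z.2 := by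
  rw [Measure.volume_eq_prod]
  refine (Measure.ae_prod_iff_ae_ae ?_).2 (.of_forall fun x => ?_)
  · exact (measurableSet_eq_fun measurable_fst measurable_snd).compl
  · simpa using (Measure.ae_ne volume x).mono fun y hy => hy.symm

namespace DissipativeSource

variable {k : ℝ} {f u : E3 → ℂ} {R B : ℝ}

/-- The reaction of the source with its own field. -/
def reaction (k : ℝ) (f : E3 → ℂ) : ℂ :=
  ∫ z : E3 × E3, greens k z.1 z.2 * (starRingEnd ℂ (f z.1) * f z.2)

lemma im_reaction_nonpos (h : DissipativeSource k f u R B) : (reaction k f).im ≤ 0 := by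
  have hint := h.integrable_greens_mul h.conj k
  rw [Measure.volume_eq_prod] at hint
  have e : reaction k f = ∫ x, -(starRingEnd ℂ (f x) * u x) := by
    rw [reaction, Measure.volume_eq_prod, integral_prod _ hint]
    refine integral_congr_ae (.of_forall fun x => ?_)
    simp only
    rw [h.field, mul_neg, neg_neg, ← integral_const_mul]
    refine integral_congr_ae (.of_forall fun y => ?_)
    simp only
    ring
  have hi : Integrable fun x => -(starRingEnd ℂ (f x) * u x) := by
    refine hint.integral_prod_left.congr (.of_forall fun x => ?_)
    simp only
    rw [h.field, mul_neg, neg_neg, ← integral_const_mul]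
    refine integral_congr_ae (.of_forall fun y => ?_)
    simp only
    ring
  rw [e]
  have := integral_im hi
  simp only [RCLike.im_to_complex] at this
  rw [← this]
  refine integral_nonpos fun x => ?_
  simpa using h.dissipative x

lemma reaction_sub_conj (hf : BddSupp f R B) (hk : 0 < k) :
    reaction k f - starRingEnd ℂ (reaction k f) = Complex.I * k / (8 * Real.pi ^ 2) *
      ∫ ω in angles, starRingEnd ℂ (laplaceT f ((-Complex.I * k) • realDirection ω)) *
        laplaceT f ((-Complex.I * k) • realDirection ω) := by
  have hint := hf.integrable_greens_mul hf.conj k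
  have hconj : starRingEnd ℂ (reaction k f) =
      ∫ z : E3 × E3, starRingEnd ℂ (greens k z.1 z.2) * (starRingEnd ℂ (f z.1) * f z.2) := by
    rw [reaction, ← integral_conj, Measure.volume_eq_prod, ← integral_prod_swap]
    refine integral_congr_ae (.of_forall fun z => ?_)
    simp only [Prod.fst_swap, Prod.snd_swap, map_mul, Complex.conj_conj]
    rw [greens_comm]
    ring
  have hint2 : Integrable fun z : E3 × E3 =>
      starRingEnd ℂ (greens k z.1 z.2) * (starRingEnd ℂ (f z.1) * f z.2) := by
    have h := hint
    rw [Measure.volume_eq_prod] at h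
    refine (Complex.conjCLE.toContinuousLinearMap.integrable_comp h.swap).congr
      (.of_forall fun z => ?_)
    simp [greens_comm k z.2 z.1, mul_comm (f z.2)]
  have hff : Integrable fun z : E3 × E3 => starRingEnd ℂ (f z.1) * f z.2 := by
    rw [Measure.volume_eq_prod]
    exact hf.conj.integrable.mul_prod hf.integrable
  rw [hconj, reaction, ← integral_sub hint hint2]
  have e1 : ∀ᵐ z : E3 × E3, greens k z.1 z.2 * (starRingEnd ℂ (f z.1) * f z.2) -
      starRingEnd ℂ (greens k z.1 z.2) * (starRingEnd ℂ (f z.1) * f z.2) =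
      Complex.I * k / (8 * Real.pi ^ 2) * ∫ ω in angles,
        Complex.exp (Complex.I * k * pairing (realDirection ω) (z.1 - z.2)) *
          (starRingEnd ℂ (f z.1) * f z.2) := by
    filter_upwards [ae_fst_ne_snd] with z hz
    rw [integral_mul_const, ← mul_assoc (Complex.I * k / (8 * Real.pi ^ 2) : ℂ),
      ← greens_sub_conj hk hz]
    ring
  rw [integral_congr_ae e1, integral_const_mul, integral_integral_swap]
  · congr 1
    refine integral_congr_ae (.of_forall fun ω => ?_)
    simp only [laplaceT]
    rw [← integral_conj, ← integral_prod_mul, Measure.volume_eq_prod]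
    refine integral_congr_ae (.of_forall fun z => ?_)
    simp only [map_mul, ← Complex.exp_conj, pairing_sub, pairing_smul, pairing_realDirection,
      Complex.conj_ofReal, map_neg, Complex.conj_I]
    rw [mul_sub, sub_eq_add_neg, Complex.exp_add]
    ring_nf
  · have := (hff.comp_fst (volume.restrict angles)).bdd_mul (c := 1)
      (f := fun w : (E3 × E3) × (ℝ × ℝ) =>
        Complex.exp (Complex.I * k * pairing (realDirection w.2) (w.1.1 - w.1.2)))
      (((continuous_planeWave k).comp (by fun_prop : Continuous fun w : (E3 × E3) × (ℝ × ℝ) =>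
        (w.1.1 - w.1.2, w.2))).aestronglyMeasurable)
      (.of_forall fun w => (norm_exp_pairing_realDirection k _ _).le)
    exact this

/-- The far field of a dissipative source vanishes. -/
lemma laplaceT_realDirection (h : DissipativeSource k f u R B) (hk : 0 < k) {ω : ℝ × ℝ}
    (hω : ω ∈ angles) : laplaceT f ((-Complex.I * k) • realDirection ω) = 0 := by
  set F : ℝ × ℝ → ℂ := fun ω => laplaceT f ((-Complex.I * k) • realDirection ω) with hF
  have hFc : Continuous F := h.differentiable_laplaceT.continuous.comp
    (continuous_realDirection.const_smul (-Complex.I * k))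
  have hn : ∀ ω, ‖F ω‖ ≤ ∫ y, ‖f y‖ := by
    intro ω
    refine norm_integral_le_of_norm_le h.integrable.norm (.of_forall fun y => ?_)
    have := norm_exp_pairing_realDirection (-k) ω y
    rw [norm_mul, pairing_smul]
    simp only [Complex.ofReal_neg, mul_neg, neg_mul] at this ⊢
    rw [this, one_mul]
  have hint : IntegrableOn (fun ω => ‖F ω‖ ^ 2) angles := by
    refine Integrable.of_bound (C := (∫ y, ‖f y‖) ^ 2)
      (by fun_prop : Continuous _).aestronglyMeasurable (.of_forall fun ω => ?_)
    rw [Real.norm_of_nonneg (by positivity)]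
    gcongr
    exact hn ω
  have h1 := reaction_sub_conj h.toBddSupp hk
  have h2 : ∫ ω in angles, starRingEnd ℂ (F ω) * F ω = ((∫ ω in angles, ‖F ω‖ ^ 2 : ℝ) : ℂ) := by
    rw [← integral_complex_ofReal]
    refine integral_congr_ae (.of_forall fun ω => ?_)
    simp only [Complex.conj_mul', Complex.ofReal_pow]
  rw [h2, Complex.sub_conj] at h1
  have h3 : (reaction k f).im = k / (16 * Real.pi ^ 2) * ∫ ω in angles, ‖F ω‖ ^ 2 := by
    have e : Complex.I * k / (8 * Real.pi ^ 2) * ((∫ ω in angles, ‖F ω‖ ^ 2 : ℝ) : ℂ) =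
        ((k / (8 * Real.pi ^ 2) * ∫ ω in angles, ‖F ω‖ ^ 2 : ℝ) : ℂ) * Complex.I := by
      push_cast
      ring
    rw [e] at h1
    have h5 := Complex.ofReal_injective (mul_right_cancel₀ Complex.I_ne_zero h1)
    linear_combination h5 / 2
  have h4 : ∫ ω in angles, ‖F ω‖ ^ 2 = 0 := by
    have h5 := h.im_reaction_nonpos
    have h6 : 0 ≤ ∫ ω in angles, ‖F ω‖ ^ 2 := integral_nonneg fun ω => by positivity
    have h7 : 0 < k / (16 * Real.pi ^ 2) := by positivity
    nlinarith
  rw [integral_eq_zero_iff_of_nonneg (fun ω => by positivity) hint] at h4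
  have h5 := Measure.eqOn_open_of_ae_eq h4 isOpen_angles (by fun_prop) continuousOn_const
  exact norm_eq_zero.1 (pow_eq_zero_iff two_ne_zero |>.1 (h5 hω))

end DissipativeSource

/-! ### Fields of dissipative sources have bounded support -/

lemma measurable_aperture : Measurable aperture := by
  unfold aperture
  fun_prop

/-- Complex directions sampling the plane waves that decay along the first axis. -/
def evanescentDirection (ω : ℝ × ℝ) : Fin 3 → ℂ :=
  direction (1 + Complex.I * ω.1) (aperture ω.1) ω.2

/-- The parameter domain of `evanescentDirection`. -/
def halfStrip : Set (ℝ × ℝ) := Set.Ioi 0 ×ˢ Set.Ioo 0 (2 * Real.pi)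

lemma measurable_evanescentWave (k : ℝ) : Measurable fun z : E3 × (ℝ × ℝ) =>
    Complex.exp (Complex.I * k * pairing (evanescentDirection z.2) z.1) := by
  have : Measurable fun z : E3 × (ℝ × ℝ) => aperture z.2.1 :=
    measurable_aperture.comp (by fun_prop)
  simp only [evanescentDirection, pairing_direction]
  fun_prop

lemma norm_evanescentWave_le {k : ℝ} (hk : 0 < k) {δ ρ : ℝ} {w : E3} (hδ : δ ≤ w 0)
    (hρ : ‖w‖ ≤ ρ) {ω : ℝ × ℝ} (hω : ω ∈ halfStrip) :
    ‖Complex.exp (Complex.I * k * pairing (evanescentDirection ω) w)‖ ≤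
      Real.exp (2 * k * ρ) * Real.exp (-(k * δ) * ω.1) := by
  have ht : 0 < ω.1 := hω.1
  have e : (Complex.I * k * pairing (evanescentDirection ω) w).re =
      -(k * (ω.1 * w 0 + (aperture ω.1).im *
        (w 1 * Real.cos ω.2 + w 2 * Real.sin ω.2))) := by
    rw [evanescentDirection, pairing_direction]
    rw [← Complex.ofReal_mul, ← Complex.ofReal_mul, ← Complex.ofReal_add]
    simp only [Complex.mul_re, Complex.mul_im, Complex.add_im, Complex.add_re, Complex.I_re,
      Complex.I_im, Complex.ofReal_re, Complex.ofReal_im, Complex.one_re, Complex.one_im]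
    ring
  rw [Complex.norm_exp, e, ← Real.exp_add]
  refine Real.exp_le_exp.2 ?_
  have h1 : |w 1 * Real.cos ω.2 + w 2 * Real.sin ω.2| ≤ 2 * ρ := by
    refine (abs_add_le _ _).trans ?_
    rw [abs_mul, abs_mul]
    have a1 := mul_le_mul (abs_coord_le w 1) (Real.abs_cos_le_one ω.2) (abs_nonneg _)
      (norm_nonneg _)
    have a2 := mul_le_mul (abs_coord_le w 2) (Real.abs_sin_le_one ω.2) (abs_nonneg _)
      (norm_nonneg _)
    linarith
  have h2 : |(aperture ω.1).im * (w 1 * Real.cos ω.2 + w 2 * Real.sin ω.2)| ≤ 2 * ρ := by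
    rw [abs_mul]
    have := mul_le_mul (abs_im_aperture_le ω.1) h1 (abs_nonneg _) zero_le_one
    linarith
  have h3 := neg_le_of_abs_le h2
  have h4 := mul_le_mul_of_nonneg_left hδ ht.le
  have h5 : -(2 * ρ) + ω.1 * δ ≤ ω.1 * w 0 + (aperture ω.1).im *
        (w 1 * Real.cos ω.2 + w 2 * Real.sin ω.2) := by linarith
  have h6 := mul_le_mul_of_nonneg_left h5 hk.le
  linarith

lemma integrableOn_halfStrip_exp {a : ℝ} (ha : 0 < a) :
    IntegrableOn (fun ω : ℝ × ℝ => Real.exp (-a * ω.1)) halfStrip := by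
  rw [halfStrip, Measure.volume_eq_prod, IntegrableOn, ← Measure.prod_restrict]
  exact (exp_neg_integrableOn_Ioi 0 ha).comp_fst (volume.restrict (Set.Ioo 0 (2 * Real.pi)))

lemma measurableSet_halfStrip : MeasurableSet halfStrip :=
  measurableSet_Ioi.prod measurableSet_Ioo

/-- Weyl's plane wave expansion of the Green's function. -/
lemma greens_eq_integral_evanescentWave {k : ℝ} (hk : 0 < k) {x y : E3} (hxy : 0 < (x - y) 0) :
    greens k x y = k / (8 * Real.pi ^ 2) *
      ∫ ω in halfStrip, Complex.exp (Complex.I * k * pairing (evanescentDirection ω) (x - y)) := by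
  set w := x - y with hw
  have hint : IntegrableOn (fun ω => Complex.exp (Complex.I * k *
      pairing (evanescentDirection ω) w)) halfStrip := by
    refine Integrable.mono' ((integrableOn_halfStrip_exp (mul_pos hk hxy)).const_mul
      (Real.exp (2 * k * ‖w‖))) ?_ ?_
    · exact ((measurable_evanescentWave k).comp
        (by fun_prop : Measurable fun ω : ℝ × ℝ => (w, ω))).aestronglyMeasurable
    · exact (ae_restrict_mem measurableSet_halfStrip).mono fun ω hω =>
        norm_evanescentWave_le hk le_rfl le_rfl hω
  have e : ∫ ω in halfStrip, Complex.exp (Complex.I * k * pairing (evanescentDirection ω) w) =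
      2 * Real.pi * Complex.exp (Complex.I * k * ‖w‖) / (k * ‖w‖) := by
    rw [halfStrip, Measure.volume_eq_prod] at *
    rw [setIntegral_prod _ hint, ← norm_axisDist w, ← integral_coneWave_weyl hk hxy]
    refine setIntegral_congr_fun measurableSet_Ioi fun t _ => ?_
    simp only
    rw [← integral_planeWave_circle, intervalIntegral.integral_of_le (by positivity),
      integral_Ioc_eq_integral_Ioo]
    rfl
  have hw0 : w ≠ 0 := by
    rintro h
    simp [h] at hxy
  have hr : ((‖w‖ : ℝ) : ℂ) ≠ 0 := by simpa using hw0
  have hπ : (Real.pi : ℂ) ≠ 0 := by simp [Real.pi_ne_zero]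
  have hk' : (k : ℂ) ≠ 0 := by simp [hk.ne']
  rw [e, greens, ← hw]
  push_cast
  field_simp
  ring

namespace DissipativeSource

variable {k : ℝ} {f u : E3 → ℂ} {R B : ℝ}

lemma laplaceT_direction (h : DissipativeSource k f u R B) (hk : 0 < k) {φ : ℝ}
    (hφ : φ ∈ Set.Ioo 0 (2 * Real.pi)) {s q : ℂ} (hsq : s ^ 2 + q ^ 2 = 1) :
    laplaceT f ((-Complex.I * k) • direction s q φ) = 0 := by
  set g : ℂ → ℂ := fun ζ =>
    laplaceT f ((-Complex.I * k) • direction (Complex.cos ζ) (Complex.sin ζ) φ) with hg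
  have hd : Differentiable ℂ g := by
    refine h.differentiable_laplaceT.comp
      (f := fun ζ => (-Complex.I * k) • direction (Complex.cos ζ) (Complex.sin ζ) φ) ?_
    refine Differentiable.const_smul ?_ (-Complex.I * k)
    refine differentiable_pi.2 fun i => ?_
    fin_cases i <;> simp [direction]
  have hreal : ∀ θ ∈ Set.Ioo 0 Real.pi, g (θ : ℝ) = 0 := by
    intro θ hθ
    have hs := Real.sin_pos_of_mem_Ioo hθ
    have hm : (Real.cos θ, φ) ∈ angles := by
      refine ⟨⟨?_, ?_⟩, hφ⟩
      · nlinarith [Real.sin_sq_add_cos_sq θ, Real.neg_one_le_cos θ]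
      · nlinarith [Real.sin_sq_add_cos_sq θ, Real.cos_le_one θ]
    have := h.laplaceT_realDirection hk hm
    rw [realDirection] at this
    simp only [← Real.abs_sin_eq_sqrt_one_sub_cos_sq, abs_of_pos hs] at this
    simpa [hg] using this
  have hfreq : ∃ᶠ ζ in 𝓝[≠] ((Real.pi / 2 : ℝ) : ℂ), g ζ = 0 := by
    have ht : Tendsto (fun θ : ℝ => (θ : ℂ)) (𝓝[≠] (Real.pi / 2))
        (𝓝[≠] ((Real.pi / 2 : ℝ) : ℂ)) :=
      Complex.continuous_ofReal.continuousWithinAt.tendsto_nhdsWithin fun θ hθ => by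
        simpa using fun e => hθ (Complex.ofReal_injective (by simpa using e))
    refine ht.frequently (Eventually.frequently ?_)
    refine nhdsWithin_le_nhds ?_
    filter_upwards [Ioo_mem_nhds (a := 0) (b := Real.pi) (by positivity)
      (by linarith [Real.pi_pos])] with θ hθ using hreal θ hθ
  have hz : ∀ ζ, g ζ = 0 := fun ζ =>
    (Complex.analyticOnNhd_univ_iff_differentiable.2 hd)
      |>.eqOn_zero_of_preconnected_of_frequently_eq_zero isPreconnected_univ (Set.mem_univ _)
        hfreq (Set.mem_univ ζ)
  obtain ⟨ζ, rfl⟩ := Complex.cos_surjective s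
  have hq : q ^ 2 = Complex.sin ζ ^ 2 := by
    linear_combination hsq - Complex.sin_sq_add_cos_sq ζ
  rcases sq_eq_sq_iff_eq_or_eq_neg.1 hq with rfl | rfl
  · exact hz ζ
  · simpa [hg] using hz (-ζ)

lemma field_eq_zero_of_lt_coord (h : DissipativeSource k f u R B) (hk : 0 < k) {x : E3}
    (hx : R < x 0) : u x = 0 := by
  have e1 : ∀ y, greens k x y * f y = k / (8 * Real.pi ^ 2) * ∫ ω in halfStrip,
      Complex.exp (Complex.I * k * pairing (evanescentDirection ω) (x - y)) * f y := by
    intro y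
    by_cases hy : R < ‖y‖
    · simp [h.supp y hy]
    rw [integral_mul_const, greens_eq_integral_evanescentWave hk, mul_assoc]
    have := (le_abs_self _).trans (abs_coord_le y 0)
    simp only [PiLp.sub_apply]
    linarith
  rw [h.field, neg_eq_zero, integral_congr_ae (.of_forall e1), integral_const_mul,
    integral_integral_swap]
  · convert! mul_zero _
    refine setIntegral_eq_zero_of_forall_eq_zero fun ω hω => ?_
    have h0 := h.laplaceT_direction hk hω.2 (s := 1 + Complex.I * ω.1) (q := aperture ω.1) (by
      rw [aperture_sq]
      linear_combination (ω.1 : ℂ) ^ 2 * Complex.I_sq)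
    have e : ∀ y, Complex.exp (Complex.I * k * pairing (evanescentDirection ω) (x - y)) * f y =
        Complex.exp (Complex.I * k * pairing (evanescentDirection ω) x) *
        (Complex.exp (pairing ((-Complex.I * k) • evanescentDirection ω) y) * f y) := by
      intro y
      rw [← mul_assoc, ← Complex.exp_add, pairing_sub, pairing_smul]
      ring_nf
    simp only [e]
    rw [integral_const_mul]
    convert! mul_zero _
  · have hb := (h.integrable.norm.mul_prod (integrableOn_halfStrip_exp
      (mul_pos hk (sub_pos.2 hx)))).const_mul (Real.exp (2 * k * (‖x‖ + R)))
    refine hb.mono' ?_ ?_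
    · have hm : Measurable fun z : E3 × (ℝ × ℝ) => (x - z.1, z.2) := by fun_prop
      have hm2 := (measurable_evanescentWave k).comp hm
      exact (hm2.mul (h.measurable.comp measurable_fst)).aestronglyMeasurable
    · have hae : ∀ᵐ z : E3 × (ℝ × ℝ) ∂volume.prod (volume.restrict halfStrip),
          z.2 ∈ halfStrip :=
        Measure.quasiMeasurePreserving_snd.ae (ae_restrict_mem measurableSet_halfStrip)
      filter_upwards [hae] with z hz
      by_cases hy : R < ‖z.1‖
      · simp [Function.uncurry, h.supp _ hy]
      simp only [Function.uncurry, norm_mul]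
      have hw : ‖x - z.1‖ ≤ ‖x‖ + R := by
        have := norm_sub_le x z.1
        linarith
      have hw0 : x 0 - R ≤ (x - z.1) 0 := by
        have := (le_abs_self _).trans (abs_coord_le z.1 0)
        simp only [PiLp.sub_apply]
        linarith
      have := norm_evanescentWave_le hk hw0 hw hz
      calc _ ≤ _ := mul_le_mul_of_nonneg_right this (norm_nonneg (f z.1))
        _ = _ := by ring

lemma comp_isometry (h : DissipativeSource k f u R B) (A : E3 ≃ₗᵢ[ℝ] E3) :
    DissipativeSource k (f ∘ A) (u ∘ A) R B where
  measurable := h.measurable.comp A.continuous.measurable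
  bound y := h.bound _
  supp y hy := h.supp _ (by simpa using hy)
  dissipative x := h.dissipative _
  field x := by
    simp only [Function.comp_apply]
    rw [h.field, ← A.measurePreserving.integral_comp A.toHomeomorph.measurableEmbedding]
    simp only [greens, ← map_sub, A.norm_map]

/-- Rellich's lemma for dissipative sources. -/
lemma field_eq_zero (h : DissipativeSource k f u R B) (hk : 0 < k) {x : E3} (hx : R < ‖x‖) :
    u x = 0 := by
  set e : E3 := EuclideanSpace.single 0 ‖x‖
  have hn : ‖e‖ = ‖x‖ := by simp [e]
  set A := (ℝ ∙ (e - x))ᗮ.reflection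
  have hA : A e = x := Submodule.reflection_sub hn
  have := (h.comp_isometry A).field_eq_zero_of_lt_coord hk (x := e) (by simpa [e] using hx)
  simpa [hA] using this

end DissipativeSource

/-! ### The Green's function is a fundamental solution -/

/-- The partial derivative along the `i`-th coordinate. -/
def partialD (i : Fin 3) (ψ : E3 → ℂ) (x : E3) : ℂ := fderiv ℝ ψ x (EuclideanSpace.single i 1)

/-- The Helmholtz operator. -/
def helmholtz (k : ℝ) (ψ : E3 → ℂ) (x : E3) : ℂ :=
  ∑ i, partialD i (partialD i ψ) x + k ^ 2 * ψ x

lemma contDiff_partialD {ψ : E3 → ℂ} {n : ℕ} (hψ : ContDiff ℝ (n + 1 : ℕ) ψ) (i : Fin 3) :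
    ContDiff ℝ n (partialD i ψ) :=
  ContDiff.clm_apply (hψ.fderiv_right (by simp)) contDiff_const

lemma hasLineDerivAt_partialD {ψ : E3 → ℂ} (hψ : ContDiff ℝ 1 ψ) (i : Fin 3) (x : E3) :
    HasLineDerivAt ℝ ψ (partialD i ψ x) x (EuclideanSpace.single i 1) :=
  (hψ.differentiable one_ne_zero x).hasFDerivAt.hasLineDerivAt _

lemma continuous_helmholtz {ψ : E3 → ℂ} (hψ : ContDiff ℝ 2 ψ) (k : ℝ) :
    Continuous (helmholtz k ψ) := by
  have h : ∀ i, Continuous (partialD i (partialD i ψ)) := fun i =>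
    (contDiff_partialD (n := 0) (contDiff_partialD (n := 1) hψ i) i).continuous
  have := hψ.continuous
  unfold helmholtz
  fun_prop

lemma partialD_comp_add (i : Fin 3) (ψ : E3 → ℂ) (y : E3) :
    partialD i (fun x => ψ (x + y)) = fun x => partialD i ψ (x + y) := by
  funext x
  rw [partialD, fderiv_comp_add_right]
  rfl

lemma helmholtz_comp_add (k : ℝ) (ψ : E3 → ℂ) (y x : E3) :
    helmholtz k (fun x => ψ (x + y)) x = helmholtz k ψ (x + y) := by
  simp only [helmholtz, partialD_comp_add]

lemma integral_mul_partialD {a a' b : E3 → ℂ} {i : Fin 3} (ha : Continuous a)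
    (ha' : Continuous a') (hd : ∀ x, HasLineDerivAt ℝ a (a' x) x (EuclideanSpace.single i 1))
    (hb : ContDiff ℝ 1 b) (hs : HasCompactSupport b) :
    ∫ x, a x * partialD i b x = -∫ x, a' x * b x := by
  have hc : Continuous (partialD i b) := (contDiff_partialD (n := 0) hb i).continuous
  have hs' : HasCompactSupport (partialD i b) := hs.fderiv_apply ℝ _
  exact integral_bilinear_hasLineDerivAt_right_eq_neg_left_of_integrable
    (B := ContinuousLinearMap.mul ℝ ℂ)
    ((ha'.mul hb.continuous).integrable_of_hasCompactSupport hs.mul_left)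
    ((ha.mul hc).integrable_of_hasCompactSupport hs'.mul_left)
    ((ha.mul hb.continuous).integrable_of_hasCompactSupport hs.mul_left)
    (fun x _ => hd x) (fun x _ => hasLineDerivAt_partialD hb i x)

/-- The radial profile of an outgoing spherical wave. -/
def outgoing (k r : ℝ) : ℂ := Complex.exp (Complex.I * k * r) * (r : ℂ)⁻¹

/-- The derivative of `outgoing` divided by the radius. -/
def outgoing₁ (k r : ℝ) : ℂ :=
  Complex.exp (Complex.I * k * r) * (Complex.I * k * (r : ℂ)⁻¹ ^ 2 - (r : ℂ)⁻¹ ^ 3)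

/-- The derivative of `outgoing₁` divided by the radius. -/
def outgoing₂ (k r : ℝ) : ℂ :=
  Complex.exp (Complex.I * k * r) *
    (-(k : ℂ) ^ 2 * (r : ℂ)⁻¹ ^ 3 - 3 * Complex.I * k * (r : ℂ)⁻¹ ^ 4 + 3 * (r : ℂ)⁻¹ ^ 5)

lemma hasDerivAt_outgoing (k : ℝ) {r : ℝ} (hr : r ≠ 0) :
    HasDerivAt (outgoing k) (r * outgoing₁ k r) r := by
  have hr' : (r : ℂ) ≠ 0 := by simpa using hr
  have h1 : HasDerivAt (fun r : ℝ => (r : ℂ)) 1 r := Complex.ofRealCLM.hasDerivAt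
  have h2 := (h1.const_mul (Complex.I * k)).cexp.mul (h1.inv hr')
  convert! h2 using 1
  simp only [outgoing₁, Pi.inv_apply]
  field_simp
  ring

lemma hasDerivAt_outgoing₁ (k : ℝ) {r : ℝ} (hr : r ≠ 0) :
    HasDerivAt (outgoing₁ k) (r * outgoing₂ k r) r := by
  have hr' : (r : ℂ) ≠ 0 := by simpa using hr
  have h1 : HasDerivAt (fun r : ℝ => (r : ℂ)) 1 r := Complex.ofRealCLM.hasDerivAt
  have h2 := (h1.const_mul (Complex.I * k)).cexp.mul
    ((((h1.inv hr').pow 2).const_mul (Complex.I * k)).sub ((h1.inv hr').pow 3))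
  convert! h2 using 1
  rw [outgoing₂]
  simp
  field_simp
  ring_nf
  rw [Complex.I_sq]
  ring

/-- The mollified distance to the origin. -/
def softNorm (δ : ℝ) (x : E3) : ℝ := √(‖x‖ ^ 2 + δ ^ 2)

lemma sq_softNorm (δ : ℝ) (x : E3) : softNorm δ x ^ 2 = ‖x‖ ^ 2 + δ ^ 2 :=
  Real.sq_sqrt (by positivity)

lemma softNorm_pos {δ : ℝ} (hδ : 0 < δ) (x : E3) : 0 < softNorm δ x :=
  Real.sqrt_pos.2 (by positivity)

lemma norm_le_softNorm (δ : ℝ) (x : E3) : ‖x‖ ≤ softNorm δ x :=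
  Real.le_sqrt_of_sq_le (by nlinarith)

lemma continuous_softNorm (δ : ℝ) : Continuous (softNorm δ) := by
  unfold softNorm; fun_prop

lemma hasLineDerivAt_softNorm {δ : ℝ} (hδ : 0 < δ) (i : Fin 3) (x : E3) :
    HasLineDerivAt ℝ (softNorm δ) (x i / softNorm δ x) x (EuclideanSpace.single i 1) := by
  have h1 : HasFDerivAt (fun x : E3 => ‖x‖ ^ 2 + δ ^ 2) (2 • innerSL ℝ x) x :=
    (hasStrictFDerivAt_norm_sq x).hasFDerivAt.add_const _
  have h2 := (h1.sqrt (by positivity)).hasLineDerivAt (EuclideanSpace.single i (1 : ℝ))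
  convert! h2 using 1
  simp [softNorm, EuclideanSpace.inner_single_right]
  field_simp

lemma hasLineDerivAt_coord (i : Fin 3) (x : E3) :
    HasLineDerivAt ℝ (fun x : E3 => ((x i : ℝ) : ℂ)) 1 x (EuclideanSpace.single i 1) := by
  have h : HasDerivAt (fun t : ℝ => ((x i + t : ℝ) : ℂ)) 1 0 := by
    simpa using ((hasDerivAt_id (0 : ℝ)).const_add (x i)).ofReal_comp
  simpa [HasLineDerivAt] using h

lemma hasLineDerivAt_comp_softNorm {δ : ℝ} (hδ : 0 < δ) {g g₁ : ℝ → ℂ}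
    (hg : ∀ r, r ≠ 0 → HasDerivAt g (r * g₁ r) r) (i : Fin 3) (x : E3) :
    HasLineDerivAt ℝ (fun x => g (softNorm δ x)) (x i * g₁ (softNorm δ x)) x
      (EuclideanSpace.single i 1) := by
  have hρ := (softNorm_pos hδ x).ne'
  have h0 : x + (0 : ℝ) • EuclideanSpace.single i (1 : ℝ) = x := by simp
  have h1 : HasDerivAt g (softNorm δ x * g₁ (softNorm δ x))
      (softNorm δ (x + (0 : ℝ) • EuclideanSpace.single i (1 : ℝ))) := by
    rw [h0]
    exact hg _ hρ
  have h2 := h1.scomp (0 : ℝ) (hasLineDerivAt_softNorm hδ i x)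
  refine HasDerivAt.congr_deriv (f' := _) h2 ?_
  rw [Complex.real_smul]
  push_cast
  have : (softNorm δ x : ℂ) ≠ 0 := by simpa using hρ
  field_simp

lemma continuous_comp_softNorm {δ : ℝ} (hδ : 0 < δ) {g : ℝ → ℂ} (hg : ContinuousOn g (Set.Ioi 0)) :
    Continuous fun x => g (softNorm δ x) :=
  hg.comp_continuous (continuous_softNorm δ) (softNorm_pos hδ)

lemma continuousOn_ofReal_inv : ContinuousOn (fun r : ℝ => (r : ℂ)⁻¹) (Set.Ioi 0) :=
  Complex.continuous_ofReal.continuousOn.inv₀ fun r hr => by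
    simpa using (Set.mem_Ioi.1 hr).ne'

lemma continuousOn_outgoing (k : ℝ) : ContinuousOn (outgoing k) (Set.Ioi 0) :=
  fun _ hr => (hasDerivAt_outgoing k (Set.mem_Ioi.1 hr).ne').continuousAt.continuousWithinAt

lemma continuousOn_outgoing₁ (k : ℝ) : ContinuousOn (outgoing₁ k) (Set.Ioi 0) :=
  fun _ hr => (hasDerivAt_outgoing₁ k (Set.mem_Ioi.1 hr).ne').continuousAt.continuousWithinAt

lemma continuousOn_outgoing₂ (k : ℝ) : ContinuousOn (outgoing₂ k) (Set.Ioi 0) := by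
  have := continuousOn_ofReal_inv
  unfold outgoing₂
  fun_prop

/-- Green's identity for the mollified outgoing wave. -/
lemma integral_outgoing_softNorm_mul_helmholtz {δ : ℝ} (hδ : 0 < δ) (k : ℝ) {ψ : E3 → ℂ}
    (hψ : ContDiff ℝ 2 ψ) (hs : HasCompactSupport ψ) :
    ∫ x, outgoing k (softNorm δ x) * helmholtz k ψ x =
      -∫ x, δ ^ 2 * outgoing₂ k (softNorm δ x) * ψ x := by
  set a : E3 → ℂ := fun x => outgoing k (softNorm δ x) with ha
  set a₁ : E3 → ℂ := fun x => outgoing₁ k (softNorm δ x) with ha₁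
  set a₂ : E3 → ℂ := fun x => outgoing₂ k (softNorm δ x) with ha₂
  have hc : Continuous a := continuous_comp_softNorm hδ (continuousOn_outgoing k)
  have hc₁ : Continuous a₁ := continuous_comp_softNorm hδ (continuousOn_outgoing₁ k)
  have hc₂ : Continuous a₂ := continuous_comp_softNorm hδ (continuousOn_outgoing₂ k)
  have hψ1 : ContDiff ℝ 1 ψ := hψ.of_le (by norm_num)
  have key : ∀ i, ∫ x, a x * partialD i (partialD i ψ) x =
      ∫ x : E3, (a₁ x + x i ^ 2 * a₂ x) * ψ x := by
    intro i
    have hx : Continuous fun x : E3 => ((x i : ℝ) : ℂ) := by fun_prop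
    rw [integral_mul_partialD (a' := fun x => x i * a₁ x) hc (by fun_prop)
      (hasLineDerivAt_comp_softNorm hδ (fun r hr => hasDerivAt_outgoing k hr) i)
      (contDiff_partialD (n := 1) hψ i) (hs.fderiv_apply ℝ _),
      integral_mul_partialD (a' := fun x => a₁ x + x i ^ 2 * a₂ x) (by fun_prop) (by fun_prop)
      (fun x => ?_) hψ1 hs, neg_neg]
    have h1 := HasDerivAt.mul (hasLineDerivAt_coord i x) (hasLineDerivAt_comp_softNorm hδ
      (fun r hr => hasDerivAt_outgoing₁ k hr) i x)
    refine HasDerivAt.congr_deriv (f' := _) h1 ?_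
    simp [ha₁, ha₂]
    ring
  have hi : ∀ i, Integrable fun x => a x * partialD i (partialD i ψ) x := fun i =>
    (hc.mul (contDiff_partialD (n := 0) (contDiff_partialD (n := 1) hψ i) i).continuous)
      |>.integrable_of_hasCompactSupport ((hs.fderiv_apply ℝ _).fderiv_apply ℝ _).mul_left
  have hi2 : ∀ i : Fin 3, Integrable fun x : E3 => (a₁ x + x i ^ 2 * a₂ x) * ψ x := fun i => by
    have hx : Continuous fun x : E3 => ((x i : ℝ) : ℂ) := by fun_prop
    exact Continuous.integrable_of_hasCompactSupport (by fun_prop) hs.mul_left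
  have hi0 : Integrable fun x => a x * (k ^ 2 * ψ x) :=
    Continuous.integrable_of_hasCompactSupport (by fun_prop) hs.mul_left.mul_left
  simp only [helmholtz, mul_add, Finset.mul_sum]
  rw [integral_add (integrable_finsetSum _ fun i _ => hi i) hi0,
    integral_finsetSum _ fun i _ => hi i, Finset.sum_congr rfl fun i _ => key i,
    ← integral_finsetSum _ fun i _ => hi2 i,
    ← integral_add (integrable_finsetSum _ fun i _ => hi2 i) hi0, ← integral_neg]
  refine integral_congr_ae (.of_forall fun x => ?_)
  have hn : ((softNorm δ x : ℝ) : ℂ) ^ 2 = x 0 ^ 2 + x 1 ^ 2 + x 2 ^ 2 + δ ^ 2 := by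
    rw [← Complex.ofReal_pow, sq_softNorm, EuclideanSpace.real_norm_sq_eq, Fin.sum_univ_three]
    push_cast
    ring
  have hρ : ((softNorm δ x : ℝ) : ℂ) ≠ 0 := by simpa using (softNorm_pos hδ x).ne'
  have e : 3 * a₁ x + (x 0 ^ 2 + x 1 ^ 2 + x 2 ^ 2) * a₂ x + k ^ 2 * a x = -(δ ^ 2 * a₂ x) := by
    have e2 : 3 * a₁ x + ((softNorm δ x : ℝ) : ℂ) ^ 2 * a₂ x + k ^ 2 * a x = 0 := by
      simp only [ha, ha₁, ha₂, outgoing, outgoing₁, outgoing₂]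
      field_simp
      ring
    rw [hn] at e2
    linear_combination e2
  simp only [Fin.sum_univ_three]
  linear_combination e * ψ x

lemma BddSupp.exists_of_continuous {g : E3 → ℂ} (hg : Continuous g) (hs : HasCompactSupport g) :
    ∃ R B, BddSupp g R B := by
  obtain ⟨B, hB⟩ := hg.bounded_above_of_compact_support hs
  obtain ⟨R, hR⟩ := hs.isCompact.isBounded.subset_closedBall 0
  refine ⟨R, B, hg.measurable, hB, fun y hy => image_eq_zero_of_notMem_tsupport fun h => ?_⟩
  have := hR h
  rw [mem_closedBall_zero_iff] at this
  linarith

lemma BddSupp.mono {f : E3 → ℂ} {R R' B : ℝ} (hf : BddSupp f R B) (h : R ≤ R') :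
    BddSupp f R' B :=
  ⟨hf.measurable, hf.bound, fun y hy => hf.supp y (h.trans_lt hy)⟩

lemma hasCompactSupport_helmholtz {ψ : E3 → ℂ} (hs : HasCompactSupport ψ) (k : ℝ) :
    HasCompactSupport (helmholtz k ψ) := by
  refine hs.mono' fun x hx => ?_
  by_contra h
  refine hx ?_
  have h1 : ∀ i, partialD i (partialD i ψ) x = 0 := fun i => by
    refine image_eq_zero_of_notMem_tsupport fun h2 => h ?_
    exact tsupport_fderiv_apply_subset ℝ _ (tsupport_fderiv_apply_subset ℝ _ h2)
  simp [helmholtz, h1, image_eq_zero_of_notMem_tsupport h]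

lemma softNorm_smul {δ : ℝ} (hδ : 0 < δ) (w : E3) : softNorm δ (δ • w) = δ * softNorm 1 w := by
  rw [softNorm, softNorm, norm_smul, Real.norm_of_nonneg hδ.le]
  nth_rw 3 [← Real.sqrt_sq hδ.le]
  rw [← Real.sqrt_mul (by positivity)]
  ring_nf

lemma softNorm_le {δ : ℝ} (hδ : 0 ≤ δ) (x : E3) : softNorm δ x ≤ ‖x‖ + δ := by
  refine Real.sqrt_le_iff.2 ⟨by positivity, ?_⟩
  nlinarith [norm_nonneg x]

lemma integrable_softNorm_inv_pow : Integrable fun w : E3 => 3 * (softNorm 1 w)⁻¹ ^ 5 := by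
  have h := (integrable_rpow_neg_one_add_norm_sq (E := E3) (μ := volume) (r := 5)
    (by norm_num)).const_mul 3
  refine h.congr (.of_forall fun w => ?_)
  simp only [softNorm]
  rw [Real.sqrt_eq_rpow, ← Real.rpow_neg (by positivity),
    ← Real.rpow_mul_natCast (by positivity)]
  norm_num [add_comm]

/-- The normalising constant of the fundamental solution. -/
def deltaMass : ℝ := ∫ w : E3, 3 * (softNorm 1 w)⁻¹ ^ 5

/-- The regular factor of `outgoing₂`. -/
def regularFactor (k r : ℝ) : ℂ :=
  Complex.exp (Complex.I * k * r) * (1 - Complex.I * k * r - k ^ 2 * r ^ 2 / 3)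

lemma outgoing₂_eq (k : ℝ) {r : ℝ} (hr : r ≠ 0) :
    outgoing₂ k r = 3 * (r : ℂ)⁻¹ ^ 5 * regularFactor k r := by
  have hr' : (r : ℂ) ≠ 0 := by simpa using hr
  rw [outgoing₂, regularFactor]
  field_simp
  ring

lemma continuous_regularFactor (k : ℝ) : Continuous (regularFactor k) := by
  unfold regularFactor
  fun_prop

lemma tendsto_integral_outgoing₂ (k : ℝ) {ψ : E3 → ℂ} (hψ : Continuous ψ)
    (hs : HasCompactSupport ψ) :
    Tendsto (fun δ : ℝ => ∫ x, δ ^ 2 * outgoing₂ k (softNorm δ x) * ψ x) (𝓝[>] 0)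
      (𝓝 (deltaMass * ψ 0)) := by
  obtain ⟨R, B, hB⟩ := BddSupp.exists_of_continuous hψ hs
  have hscale : ∀ δ : ℝ, 0 < δ → ∫ x, δ ^ 2 * outgoing₂ k (softNorm δ x) * ψ x =
      ∫ w, ((3 * (softNorm 1 w)⁻¹ ^ 5 : ℝ) : ℂ) *
        (regularFactor k (δ * softNorm 1 w) * ψ (δ • w)) := by
    intro δ hδ
    have h := Measure.integral_comp_smul (volume : Measure E3)
      (fun x => δ ^ 2 * outgoing₂ k (softNorm δ x) * ψ x) δ
    rw [finrank_euclideanSpace_fin, abs_of_pos (by positivity), eq_inv_smul_iff₀ (by positivity),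
      ← integral_smul] at h
    rw [← h]
    refine integral_congr_ae (.of_forall fun w => ?_)
    have hw := softNorm_pos one_pos w
    have hw' : (softNorm 1 w : ℂ) ≠ 0 := by simpa using hw.ne'
    have hδ' : (δ : ℂ) ≠ 0 := by simpa using hδ.ne'
    simp only
    rw [softNorm_smul hδ, outgoing₂_eq k (by positivity), Complex.real_smul]
    push_cast
    field_simp
  obtain ⟨H, hH⟩ := (isCompact_Icc (a := 0) (b := |R| + 1)).exists_bound_of_continuousOn
    (continuous_regularFactor k).continuousOn
  have hlim : Tendsto (fun δ : ℝ => ∫ w, ((3 * (softNorm 1 w)⁻¹ ^ 5 : ℝ) : ℂ) *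
      (regularFactor k (δ * softNorm 1 w) * ψ (δ • w))) (𝓝[>] 0)
      (𝓝 (∫ w, ((3 * (softNorm 1 w)⁻¹ ^ 5 : ℝ) : ℂ) * ψ 0)) := by
    have hcs := continuous_softNorm 1
    have hcr := continuous_regularFactor k
    have hci : Continuous fun w : E3 => 3 * (softNorm 1 w)⁻¹ ^ 5 :=
      continuous_const.mul ((hcs.inv₀ fun w => (softNorm_pos one_pos w).ne').pow 5)
    refine tendsto_integral_filter_of_dominated_convergence
      (fun w => (3 * (softNorm 1 w)⁻¹ ^ 5) * (H * B)) ?_ ?_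
      (integrable_softNorm_inv_pow.mul_const _) (.of_forall fun w => ?_)
    · exact .of_forall fun δ => Continuous.aestronglyMeasurable (by fun_prop)
    · filter_upwards [Ioc_mem_nhdsGT one_pos] with δ hδ
      refine .of_forall fun w => ?_
      have hw := softNorm_pos one_pos w
      have h0 : 0 ≤ 3 * (softNorm 1 w)⁻¹ ^ 5 := by positivity
      have hH0 : 0 ≤ H := (norm_nonneg _).trans (hH 0 ⟨le_rfl, by positivity⟩)
      rw [norm_mul, Complex.norm_real, Real.norm_of_nonneg h0, norm_mul]
      refine mul_le_mul_of_nonneg_left ?_ h0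
      by_cases hy : R < ‖δ • w‖
      · rw [hB.supp _ hy]
        simpa using mul_nonneg hH0 hB.nonneg
      · refine mul_le_mul (hH _ ⟨mul_nonneg hδ.1.le hw.le, ?_⟩) (hB.bound _) (norm_nonneg _) hH0
        rw [← softNorm_smul hδ.1]
        have := softNorm_le hδ.1.le (δ • w)
        have := le_abs_self R
        have := hδ.2
        linarith
    · have h1 : Tendsto (fun δ : ℝ => ((3 * (softNorm 1 w)⁻¹ ^ 5 : ℝ) : ℂ) *
          (regularFactor k (δ * softNorm 1 w) * ψ (δ • w))) (𝓝 0)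
          (𝓝 (((3 * (softNorm 1 w)⁻¹ ^ 5 : ℝ) : ℂ) *
          (regularFactor k ((0 : ℝ) * softNorm 1 w) * ψ ((0 : ℝ) • w)))) :=
        Continuous.tendsto (by fun_prop) 0
      have h2 : regularFactor k 0 = 1 := by simp [regularFactor]
      rw [zero_mul, zero_smul, h2, one_mul] at h1
      exact h1.mono_left nhdsWithin_le_nhds
  rw [integral_mul_const, integral_complex_ofReal] at hlim
  refine hlim.congr' ?_
  filter_upwards [self_mem_nhdsWithin] with δ hδ using (hscale δ hδ).symm

lemma tendsto_integral_outgoing (k : ℝ) {g : E3 → ℂ} (hg : Continuous g)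
    (hs : HasCompactSupport g) :
    Tendsto (fun δ : ℝ => ∫ x, outgoing k (softNorm δ x) * g x) (𝓝[>] 0)
      (𝓝 (∫ x, outgoing k ‖x‖ * g x)) := by
  obtain ⟨R, B, hB⟩ := BddSupp.exists_of_continuous hg hs
  refine tendsto_integral_filter_of_dominated_convergence
    (fun x => ‖x‖⁻¹ * ‖g x‖) ?_ ?_ ?_ ?_
  · filter_upwards [self_mem_nhdsWithin] with δ hδ
    exact ((continuous_comp_softNorm hδ (continuousOn_outgoing k)).mul hg).aestronglyMeasurable
  · filter_upwards [self_mem_nhdsWithin] with δ hδ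
    filter_upwards [Measure.ae_ne volume (0 : E3)] with x hx
    have hx' := norm_pos_iff.2 hx
    have e : Complex.I * k * (softNorm δ x : ℝ) = ((k * softNorm δ x : ℝ) : ℂ) * Complex.I := by
      push_cast; ring
    rw [norm_mul, outgoing, norm_mul, e, Complex.norm_exp_ofReal_mul_I, one_mul, norm_inv,
      Complex.norm_real, Real.norm_of_nonneg (softNorm_pos hδ x).le]
    gcongr
    exact norm_le_softNorm δ x
  · have h := (hB.integrable_mul (g := fun x => ((‖x‖⁻¹ : ℝ) : ℂ))
      (integrableOn_inv_norm R).ofReal).norm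
    simpa using h
  · filter_upwards [Measure.ae_ne volume (0 : E3)] with x hx
    have hx' := norm_pos_iff.2 hx
    have h1 : Tendsto (fun δ => softNorm δ x) (𝓝[>] 0) (𝓝 ‖x‖) := by
      have h2 : Continuous fun δ => softNorm δ x := by
        unfold softNorm; fun_prop
      have h3 := h2.tendsto 0
      simp only [softNorm, ne_eq, OfNat.ofNat_ne_zero, not_false_eq_true, zero_pow, add_zero,
        norm_nonneg, Real.sqrt_sq] at h3
      exact h3.mono_left nhdsWithin_le_nhds
    exact (((hasDerivAt_outgoing k hx'.ne').continuousAt.tendsto.comp h1).mul_const _)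

lemma integral_greens_zero_mul_helmholtz (k : ℝ) {ψ : E3 → ℂ} (hψ : ContDiff ℝ 2 ψ)
    (hs : HasCompactSupport ψ) :
    ∫ x, greens k x 0 * helmholtz k ψ x = -(deltaMass / (4 * Real.pi)) * ψ 0 := by
  have h1 := tendsto_integral_outgoing k (continuous_helmholtz hψ k)
    (hasCompactSupport_helmholtz hs k)
  have h2 := (tendsto_integral_outgoing₂ k hψ.continuous hs).neg
  have h3 := tendsto_nhds_unique (h1.congr' ?_) h2
  · have e : ∀ x, greens k x 0 * helmholtz k ψ x =
        (4 * Real.pi : ℂ)⁻¹ * (outgoing k ‖x‖ * helmholtz k ψ x) := by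
      intro x
      simp only [greens, outgoing, sub_zero]
      push_cast
      rw [div_eq_mul_inv, mul_inv]
      ring
    simp only [e]
    rw [integral_const_mul, h3]
    ring
  · filter_upwards [self_mem_nhdsWithin] with δ hδ
      using integral_outgoing_softNorm_mul_helmholtz hδ k hψ hs

/-- The Green's function is a fundamental solution of the Helmholtz equation. -/
lemma integral_greens_mul_helmholtz (k : ℝ) {ψ : E3 → ℂ} (hψ : ContDiff ℝ 2 ψ)
    (hs : HasCompactSupport ψ) (y : E3) :
    ∫ x, greens k x y * helmholtz k ψ x = -(deltaMass / (4 * Real.pi)) * ψ y := by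
  have h := integral_greens_zero_mul_helmholtz k (ψ := fun x => ψ (x + y))
    (hψ.comp (contDiff_id.add contDiff_const)) (hs.comp_homeomorph (Homeomorph.addRight y))
  simp only [helmholtz_comp_add, zero_add] at h
  rw [← h, ← integral_add_right_eq_self _ y]
  simp [greens]

/-! ### The radiated field in Laplace variables -/

/-- The bilinear square of a complex frequency. -/
def sqPairing (c : Fin 3 → ℂ) : ℂ := c 0 ^ 2 + c 1 ^ 2 + c 2 ^ 2

lemma contDiff_pairing (c : Fin 3 → ℂ) : ContDiff ℝ 2 (pairing c) := by
  have h : ∀ i : Fin 3, ContDiff ℝ 2 fun y : E3 => ((y i : ℝ) : ℂ) := fun i =>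
    Complex.ofRealCLM.contDiff.comp (contDiff_piLp_apply (p := 2) (i := i))
  exact ((contDiff_const.mul (h 0)).add (contDiff_const.mul (h 1))).add
    (contDiff_const.mul (h 2))

lemma partialD_exp_pairing (i : Fin 3) (a : ℂ) (c : Fin 3 → ℂ) :
    partialD i (fun x => a * Complex.exp (pairing c x)) =
      fun x => a * c i * Complex.exp (pairing c x) := by
  funext x
  have hc : ContDiff ℝ 2 fun x => a * Complex.exp (pairing c x) :=
    contDiff_const.mul (contDiff_pairing c).cexp
  have h1 := hasLineDerivAt_partialD (hc.of_le (by norm_num)) i x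
  refine HasLineDerivAt.unique h1 ?_
  have h2 : HasDerivAt (fun t : ℝ => pairing c x + t * c i) (c i) 0 := by
    simpa using ((Complex.ofRealCLM.hasDerivAt (x := 0)).mul_const (c i)).const_add (pairing c x)
  have h3 := h2.cexp.const_mul a
  have e : (fun t : ℝ => a * Complex.exp (pairing c (x + t • EuclideanSpace.single i 1))) =
      fun t : ℝ => a * Complex.exp (pairing c x + t * c i) := by
    funext t
    congr 2
    fin_cases i <;> simp [pairing] <;> ring
  rw [HasLineDerivAt, e]
  refine h3.congr_deriv ?_
  simp
  ring

lemma partialD_congr {i : Fin 3} {a b : E3 → ℂ} {x : E3} (h : a =ᶠ[𝓝 x] b) :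
    partialD i a =ᶠ[𝓝 x] partialD i b :=
  h.fderiv.mono fun y hy => by rw [partialD, hy, partialD]

lemma helmholtz_exp_pairing {k : ℝ} {c : Fin 3 → ℂ} {ψ : E3 → ℂ} {x : E3}
    (h : ψ =ᶠ[𝓝 x] fun x => Complex.exp (pairing c x)) :
    helmholtz k ψ x = (sqPairing c + k ^ 2) * Complex.exp (pairing c x) := by
  have h' : ψ =ᶠ[𝓝 x] fun x => 1 * Complex.exp (pairing c x) := by simpa using h
  have h1 : ∀ i, partialD i (partialD i ψ) x = c i * c i * Complex.exp (pairing c x) := by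
    intro i
    rw [(partialD_congr (partialD_congr h')).eq_of_nhds, partialD_exp_pairing,
      partialD_exp_pairing, one_mul]
  rw [helmholtz, Finset.sum_congr rfl fun i _ => h1 i, h.eq_of_nhds, Fin.sum_univ_three,
    sqPairing]
  ring

/-- A field of bounded support has the Laplace transform dictated by the Helmholtz equation. -/
lemma laplaceT_field {k : ℝ} {f u : E3 → ℂ} {R B : ℝ} (hf : BddSupp f R B)
    (hfield : ∀ x, u x = -∫ y, greens k x y * f y) (hu : ∀ x, R < ‖x‖ → u x = 0)
    (c : Fin 3 → ℂ) :
    (sqPairing c + k ^ 2) * laplaceT u c = deltaMass / (4 * Real.pi) * laplaceT f c := by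
  let χ : ContDiffBump (0 : E3) := ⟨|R| + 1, |R| + 2, by positivity, by linarith⟩
  set ψ : E3 → ℂ := fun x => (χ x : ℂ) * Complex.exp (pairing c x) with hψ
  have hχ : ∀ x, ‖x‖ < |R| + 1 → ψ =ᶠ[𝓝 x] fun x => Complex.exp (pairing c x) := by
    intro x hx
    filter_upwards [χ.eventuallyEq_one_of_mem_ball (by simpa using hx)] with y hy
    simp [hψ, hy]
  have hψs : HasCompactSupport ψ :=
    HasCompactSupport.mul_right (χ.hasCompactSupport.comp_left Complex.ofReal_zero)
  have hψd : ContDiff ℝ 2 ψ :=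
    (Complex.ofRealCLM.contDiff.comp χ.contDiff).mul (contDiff_pairing c).cexp
  obtain ⟨R', B', hh⟩ := BddSupp.exists_of_continuous (continuous_helmholtz hψd k)
    (hasCompactSupport_helmholtz hψs k)
  have hint := (hf.mono (le_max_left R R')).integrable_greens_mul (hh.mono (le_max_right R R')) k
  rw [Measure.volume_eq_prod] at hint
  have h1 : ∫ x, helmholtz k ψ x * u x = (sqPairing c + k ^ 2) * laplaceT u c := by
    rw [laplaceT, ← integral_const_mul]
    refine integral_congr_ae (.of_forall fun x => ?_)
    simp only
    by_cases hx : R < ‖x‖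
    · simp [hu x hx]
    · rw [helmholtz_exp_pairing (hχ x (by linarith [le_abs_self R])), mul_assoc]
  have h2 : ∫ x, helmholtz k ψ x * u x =
      -∫ x, ∫ y, greens k x y * (helmholtz k ψ x * f y) := by
    rw [← integral_neg]
    refine integral_congr_ae (.of_forall fun x => ?_)
    simp only
    rw [hfield, mul_neg, ← integral_const_mul]
    congr 2 with y
    ring
  have h3 : ∀ y, ∫ x, greens k x y * (helmholtz k ψ x * f y) =
      -(deltaMass / (4 * Real.pi) * (Complex.exp (pairing c y) * f y)) := by
    intro y
    simp only [← mul_assoc]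
    rw [integral_mul_const, integral_greens_mul_helmholtz k hψd hψs]
    by_cases hy : R < ‖y‖
    · simp [hf.supp y hy]
    · rw [(hχ y (by linarith [le_abs_self R])).eq_of_nhds]
      ring
  rw [← h1, h2, integral_integral_swap hint, integral_congr_ae (.of_forall h3), integral_neg,
    neg_neg, integral_const_mul, laplaceT]

/-! ### Plancherel for integrable square-integrable functions -/

section Plancherel

open scoped FourierTransform SchwartzMap ContDiff

lemma fourier_toLp_ae_eq {f : E3 → ℂ} (hf : Integrable f) (hf2 : MemLp f 2) :
    (𝓕 (hf2.toLp f) : Lp ℂ 2 (volume : Measure E3)) =ᵐ[volume] (𝓕 f : E3 → ℂ) := by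
  refine ae_eq_of_integral_contDiff_smul_eq ((Lp.memLp _).locallyIntegrable (by norm_num))
    (VectorFourier.fourierIntegral_continuous Real.continuous_fourierChar
      (by exact continuous_inner) hf).locallyIntegrable fun g hg hgs => ?_
  have hg₁ : HasCompactSupport (Complex.ofRealCLM ∘ g) := hgs.comp_left rfl
  have hg₂ : ContDiff ℝ ∞ (Complex.ofRealCLM ∘ g) := by fun_prop
  set G : 𝓢(E3, ℂ) := hg₁.toSchwartzMap hg₂ with hG
  have h1 : ∫ x, g x • (𝓕 (hf2.toLp f) : Lp ℂ 2 (volume : Measure E3)) x =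
      Lp.toTemperedDistribution (𝓕 (hf2.toLp f) : Lp ℂ 2 (volume : Measure E3)) G := by
    rw [Lp.toTemperedDistribution_apply]
    simp [hG]
  rw [h1, ← Lp.fourier_toTemperedDistribution_eq, TemperedDistribution.fourier_apply,
    Lp.toTemperedDistribution_apply]
  have h2 : ∫ x, (𝓕 G) x • (hf2.toLp f) x = ∫ x, (𝓕 (G : E3 → ℂ)) x • f x := by
    refine integral_congr_ae ?_
    filter_upwards [hf2.coeFn_toLp] with x hx
    rw [hx, SchwartzMap.fourier_coe]
  rw [h2]
  have h3 := VectorFourier.integral_fourierIntegral_smul_eq_flip (μ := volume) (ν := volume)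
    (L := innerₗ E3) Real.continuous_fourierChar (by exact continuous_inner) G.integrable hf
  rw [flip_innerₗ] at h3
  refine h3.trans (integral_congr_ae (.of_forall fun x => ?_))
  simp [hG]
  exact Or.inl rfl

/-- The Plancherel identity. -/
lemma integral_norm_sq_fourier {f : E3 → ℂ} (hf : Integrable f) (hf2 : MemLp f 2) :
    Integrable (fun ξ => ‖𝓕 f ξ‖ ^ 2) ∧ ∫ ξ, ‖𝓕 f ξ‖ ^ 2 = ∫ x, ‖f x‖ ^ 2 := by
  have h := fourier_toLp_ae_eq hf hf2
  have hm : MemLp (𝓕 f : E3 → ℂ) 2 := (memLp_congr_ae h).1 (Lp.memLp _)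
  refine ⟨hm.integrable_norm_pow (by norm_num), ?_⟩
  have h1 := Lp.norm_fourier_eq (hf2.toLp f)
  have h2 : ∀ F : Lp ℂ 2 (volume : Measure E3), ‖F‖ ^ 2 = ∫ x, ‖F x‖ ^ 2 := by
    intro F
    have h : ((‖F‖ ^ 2 : ℝ) : ℂ) = ((∫ x, ‖F x‖ ^ 2 : ℝ) : ℂ) := by
      rw [← integral_complex_ofReal]
      have h := L2.inner_def (𝕜 := ℂ) F F
      simp only [inner_self_eq_norm_sq_to_K] at h
      exact_mod_cast h
    exact_mod_cast h
  have h3 : ‖(𝓕 (hf2.toLp f) : Lp ℂ 2 (volume : Measure E3))‖ ^ 2 = ‖hf2.toLp f‖ ^ 2 := by rw [h1]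
  rw [h2, h2] at h3
  refine (integral_congr_ae ?_).trans (h3.trans (integral_congr_ae ?_))
  · filter_upwards [h] with x hx
    rw [hx]
  · filter_upwards [hf2.coeFn_toLp] with x hx
    rw [hx]

end Plancherel

/-! ### A Carleman estimate on the Fourier side -/

/-- The complex frequency turning the Laplace transform into the Fourier transform. -/
def fourierFreq (ξ : E3) : Fin 3 → ℂ := fun i => -(2 * Real.pi * Complex.I) * ξ i

lemma pairing_fourierFreq (ξ y : E3) :
    pairing (fourierFreq ξ) y = ↑(-2 * Real.pi * inner ℝ y ξ) * Complex.I := by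
  simp only [pairing, fourierFreq, PiLp.inner_apply, Fin.sum_univ_three, RCLike.inner_apply,
    conj_trivial]
  push_cast
  ring

lemma pairing_single (c : Fin 3 → ℂ) (r : ℝ) :
    pairing c (EuclideanSpace.single 0 r) = c 0 * r := by
  simp [pairing]

lemma laplaceT_comp_add_right (f : E3 → ℂ) (c : Fin 3 → ℂ) (a : E3) :
    laplaceT (fun x => f (x + a)) c = Complex.exp (-pairing c a) * laplaceT f c := by
  rw [laplaceT, laplaceT, ← integral_const_mul,
    ← integral_add_right_eq_self (fun x => Complex.exp (-pairing c a) *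
      (Complex.exp (pairing c x) * f x)) a]
  congr 1 with x
  rw [← mul_assoc, ← Complex.exp_add]
  congr 2
  have h := pairing_sub c (x + a) a
  rw [add_sub_cancel_right] at h
  rw [h]
  ring

lemma laplaceT_exp_mul (f : E3 → ℂ) (c d : Fin 3 → ℂ) :
    laplaceT (fun x => Complex.exp (pairing d x) * f x) c = laplaceT f (c + d) := by
  rw [laplaceT, laplaceT]
  congr 1 with x
  rw [← mul_assoc, ← Complex.exp_add]
  congr 2
  simp only [pairing, Pi.add_apply]
  ring

namespace BddSupp

variable {f : E3 → ℂ} {R B : ℝ}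

lemma memLp_two (hf : BddSupp f R B) : MemLp f 2 := by
  refine (memLp_two_iff_integrable_sq_norm hf.measurable.aestronglyMeasurable).2 ?_
  refine (hf.integrable.norm.const_mul B).mono' (by have := hf.measurable; fun_prop)
    (.of_forall fun x => ?_)
  rw [Real.norm_of_nonneg (by positivity), pow_two]
  gcongr
  exact hf.bound x

lemma integrable_norm_sq (hf : BddSupp f R B) : Integrable fun x => ‖f x‖ ^ 2 :=
  hf.memLp_two.integrable_norm_pow (by norm_num)

lemma integral_norm_sq_laplaceT (hf : BddSupp f R B) :
    Integrable (fun ξ => ‖laplaceT f (fourierFreq ξ)‖ ^ 2) ∧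
      ∫ ξ, ‖laplaceT f (fourierFreq ξ)‖ ^ 2 = ∫ x, ‖f x‖ ^ 2 := by
  have h : ∀ ξ, laplaceT f (fourierFreq ξ) = FourierTransform.fourier f ξ := by
    intro ξ
    simp only [laplaceT, Real.fourier_eq', pairing_fourierFreq, smul_eq_mul]
  simp only [h]
  exact integral_norm_sq_fourier hf.integrable hf.memLp_two

lemma exp_mul (hf : BddSupp f R B) (d : Fin 3 → ℂ) :
    BddSupp (fun x => Complex.exp (pairing d x) * f x) R (Real.exp (3 * ‖d‖ * R) * B) where
  measurable := by
    have := hf.measurable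
    fun_prop
  bound x := by
    have hB := hf.nonneg
    by_cases hx : ‖x‖ ≤ R
    · have h : ‖pairing d x‖ ≤ 3 * ‖d‖ * R := (norm_pairing_le d x).trans (by gcongr)
      refine (hf.norm_mul_le x fun _ => norm_exp_le_of_norm_le h).trans ?_
      gcongr
      exact hf.bound x
    · rw [hf.supp x (not_le.1 hx), mul_zero, norm_zero]
      positivity
  supp x hx := by rw [hf.supp x hx, mul_zero]

lemma translate (hf : BddSupp f R B) (a : E3) :
    BddSupp (fun x => f (x + a)) (R + ‖a‖) B where
  measurable := hf.measurable.comp (measurable_add_const a)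
  bound x := hf.bound _
  supp x hx := by
    have h : ‖x‖ ≤ ‖x + a‖ + ‖a‖ := by simpa using norm_sub_le (x + a) a
    exact hf.supp _ (by linarith)

lemma sub_translate (hf : BddSupp f R B) (a : E3) :
    BddSupp (fun x => f (x + a) - f x) (R + ‖a‖) (B + B) where
  measurable := (hf.translate a).measurable.sub hf.measurable
  bound x := (norm_sub_le _ _).trans (add_le_add (hf.bound _) (hf.bound _))
  supp x hx := by
    rw [(hf.translate a).supp x hx, hf.supp _ (by linarith [norm_nonneg a]), sub_zero]

lemma integral_norm_sq_sub_translate (hf : BddSupp f R B) {a : E3} (ha : 2 * R < ‖a‖) :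
    ∫ x, ‖f (x + a) - f x‖ ^ 2 = 2 * ∫ x, ‖f x‖ ^ 2 := by
  have h : ∀ x, ‖f (x + a) - f x‖ ^ 2 = ‖f (x + a)‖ ^ 2 + ‖f x‖ ^ 2 := by
    intro x
    by_cases hx : R < ‖x‖
    · simp [hf.supp x hx]
    · have h : ‖a‖ ≤ ‖x + a‖ + ‖x‖ := by simpa using norm_sub_le (x + a) x
      simp [hf.supp (x + a) (by linarith)]
  simp only [h]
  rw [integral_add (hf.integrable_norm_sq.comp_add_right a) hf.integrable_norm_sq,
    integral_add_right_eq_self (fun x => ‖f x‖ ^ 2)]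
  ring

end BddSupp

lemma abs_mul_norm_laplaceT_le {k : ℝ} {f u : E3 → ℂ} {m τ : ℝ} (hτ : 0 < τ)
    (h : ∀ c, ‖(sqPairing c + k ^ 2) * laplaceT u c‖ ≤ m * ‖laplaceT f c‖) (ξ : E3) :
    4 * Real.pi * τ * |ξ 0| * ‖laplaceT u (fourierFreq ξ + Pi.single 0 (τ : ℂ))‖ ≤
      m * ‖laplaceT f (fourierFreq ξ + Pi.single 0 (τ : ℂ))‖ := by
  refine le_trans ?_ (h _)
  rw [norm_mul]
  gcongr
  refine le_trans (le_of_eq ?_) (Complex.abs_im_le_norm _)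
  have e : sqPairing (fourierFreq ξ + Pi.single 0 (τ : ℂ)) + k ^ 2 =
      ((τ ^ 2 + k ^ 2 - 4 * Real.pi ^ 2 * (ξ 0 ^ 2 + ξ 1 ^ 2 + ξ 2 ^ 2) : ℝ) : ℂ) +
        ((-(4 * Real.pi * τ * ξ 0) : ℝ) : ℂ) * Complex.I := by
    simp [sqPairing, fourierFreq]
    linear_combination 4 * (Real.pi : ℂ) ^ 2 * (ξ 0 ^ 2 + ξ 1 ^ 2 + ξ 2 ^ 2) * Complex.I_sq
  rw [e, Complex.add_im, Complex.ofReal_im, Complex.im_ofReal_mul, Complex.I_im, mul_one, zero_add,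
    abs_neg, abs_mul _ (ξ 0), abs_of_pos (by positivity : 0 < 4 * Real.pi * τ)]

/-- Unique continuation for compactly supported fields: a field which dominates its source
vanishes almost everywhere. -/
lemma ae_eq_zero_of_norm_source_le {k : ℝ} {f u : E3 → ℂ} {R B C m M : ℝ} (hf : BddSupp f R B)
    (hu : BddSupp u R C) (hm : 0 ≤ m)
    (h : ∀ c, ‖(sqPairing c + k ^ 2) * laplaceT u c‖ ≤ m * ‖laplaceT f c‖)
    (hM : 0 ≤ M) (hfu : ∀ x, ‖f x‖ ≤ M * ‖u x‖) : u =ᵐ[volume] 0 := by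
  set L : ℝ := 2 * |R| + 1 with hL
  have hL0 : 0 < L := by positivity
  set τ : ℝ := L * m * M + 1 with hτ
  have hτ0 : 0 < τ := by positivity
  set d : Fin 3 → ℂ := Pi.single 0 (τ : ℂ) with hd
  set a : E3 := EuclideanSpace.single 0 L with ha
  have han : ‖a‖ = L := by simp [ha, hL0.le]
  set v : E3 → ℂ := fun x => Complex.exp (pairing d x) * u x with hv
  have hvb := hu.exp_mul d
  have hgb := hf.exp_mul d
  have hwb := hvb.sub_translate a
  obtain ⟨-, hw⟩ := hwb.integral_norm_sq_laplaceT
  obtain ⟨hgi, hg⟩ := hgb.integral_norm_sq_laplaceT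
  rw [hvb.integral_norm_sq_sub_translate (by rw [han]; linarith [le_abs_self R])] at hw
  have h1 : ∀ ξ, ‖laplaceT (fun x => v (x + a) - v x) (fourierFreq ξ)‖ ≤
      L * m / (2 * τ) * ‖laplaceT (fun x => Complex.exp (pairing d x) * f x) (fourierFreq ξ)‖ := by
    intro ξ
    have e : laplaceT (fun x => v (x + a) - v x) (fourierFreq ξ) =
        (Complex.exp (Complex.I * (2 * Real.pi * L * ξ 0 : ℝ)) - 1) *
          laplaceT v (fourierFreq ξ) := by
      have e1 := laplaceT_comp_add_right v (fourierFreq ξ) a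
      have e2 : -pairing (fourierFreq ξ) a = Complex.I * (2 * Real.pi * L * ξ 0 : ℝ) := by
        rw [ha, pairing_single, fourierFreq]
        push_cast
        ring
      rw [e2] at e1
      rw [sub_mul, ← e1, one_mul, laplaceT, laplaceT, laplaceT, ← integral_sub]
      · simp only [mul_sub]
      · exact (hvb.translate a).integrable_continuous_mul (by fun_prop)
      · exact hvb.integrable_continuous_mul (by fun_prop)
    have h2 := abs_mul_norm_laplaceT_le hτ0 h ξ
    rw [← laplaceT_exp_mul, ← laplaceT_exp_mul] at h2
    have h3 := Real.norm_exp_I_mul_ofReal_sub_one_le (x := 2 * Real.pi * L * ξ 0)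
    rw [Real.norm_eq_abs, abs_mul, abs_of_pos (by positivity)] at h3
    rw [e, norm_mul]
    calc _ ≤ 2 * Real.pi * L * |ξ 0| * ‖laplaceT v (fourierFreq ξ)‖ := by gcongr
      _ = L / (2 * τ) * (4 * Real.pi * τ * |ξ 0| * ‖laplaceT v (fourierFreq ξ)‖) := by
        field_simp
        ring
      _ ≤ L / (2 * τ) * (m * _) := by gcongr
      _ = _ := by ring
  set A := ∫ x, ‖v x‖ ^ 2 with hA
  have hA0 : 0 ≤ A := integral_nonneg fun x => by positivity
  have h4 : 2 * A ≤ (L * m / (2 * τ)) ^ 2 *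
      ∫ x, ‖Complex.exp (pairing d x) * f x‖ ^ 2 := by
    rw [← hw, ← hg, ← integral_const_mul]
    refine integral_mono_of_nonneg (.of_forall fun ξ => by positivity) (hgi.const_mul _)
      (.of_forall fun ξ => ?_)
    simp only [← mul_pow]
    gcongr
    exact h1 ξ
  have h5 : ∫ x, ‖Complex.exp (pairing d x) * f x‖ ^ 2 ≤ M ^ 2 * A := by
    rw [hA, ← integral_const_mul]
    refine integral_mono_of_nonneg (.of_forall fun ξ => by positivity)
      (hvb.integrable_norm_sq.const_mul _) (.of_forall fun x => ?_)
    simp only [← mul_pow]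
    gcongr
    rw [hv, norm_mul, norm_mul]
    calc _ ≤ ‖Complex.exp (pairing d x)‖ * (M * ‖u x‖) := by gcongr; exact hfu x
      _ = _ := by ring
  have h6 : L * m / (2 * τ) * M ≤ 1 := by
    rw [div_mul_eq_mul_div, div_le_one (by positivity)]
    linarith [show 0 ≤ L * m * M by positivity]
  have h7 : 2 * A ≤ A := calc
    _ ≤ (L * m / (2 * τ)) ^ 2 * (M ^ 2 * A) := h4.trans (by gcongr)
    _ = (L * m / (2 * τ) * M) ^ 2 * A := by ring
    _ ≤ 1 * A := by
      gcongr
      exact pow_le_one₀ (by positivity) h6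
    _ = A := one_mul A
  have h8 : A = 0 := by linarith
  rw [hA, integral_eq_zero_iff_of_nonneg (fun x => by positivity) hvb.integrable_norm_sq] at h8
  filter_upwards [h8] with x hx
  simpa [hv, Complex.exp_ne_zero] using hx

/-! ### Uniqueness -/

lemma homogeneous_solution_eq_zero {k : ℝ} (hk : 0 < k) {Ω : Set E3} (hΩo : IsOpen Ω)
    {R C M : ℝ} (hΩ : Ω ⊆ Metric.closedBall 0 R) {p u : E3 → ℂ} (hp : Measurable p)
    (hM : ∀ x, ‖p x‖ ≤ M) (him : ∀ x, (p x).im ≤ 0) (hu : Continuous u) (hC : ∀ x, ‖u x‖ ≤ C)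
    (h : ∀ x, u x = -∫ y in Ω, greens k x y * (p y * u y)) (x : E3) : u x = 0 := by
  set f : E3 → ℂ := Ω.indicator fun y => p y * u y with hf
  have hM0 : 0 ≤ M := (norm_nonneg _).trans (hM 0)
  have hfu : ∀ y, ‖f y‖ ≤ M * ‖u y‖ := by
    intro y
    refine (norm_indicator_le_norm_self _ _).trans ?_
    rw [norm_mul]
    gcongr
    exact hM y
  have hd : DissipativeSource k f u R (M * C) :=
    { measurable := (hp.mul hu.measurable).indicator hΩo.measurableSet
      bound := fun y => (hfu y).trans (by gcongr; exact hC y)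
      supp := fun y hy => Set.indicator_of_notMem (fun hyΩ => by
        have := hΩ hyΩ
        rw [mem_closedBall_zero_iff] at this
        linarith) _
      field := fun y => by
        rw [h, ← integral_indicator hΩo.measurableSet]
        congr 2 with z
        by_cases hz : z ∈ Ω <;> simp [hf, hz]
      dissipative := fun y => by
        by_cases hy : y ∈ Ω
        · have e : starRingEnd ℂ (f y) * u y =
              starRingEnd ℂ (p y) * (Complex.normSq (u y) : ℂ) := by
            rw [hf, Set.indicator_of_mem hy, map_mul, Complex.normSq_eq_conj_mul_self, mul_assoc]
          rw [e, Complex.im_mul_ofReal, Complex.conj_im]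
          exact mul_nonneg (neg_nonneg.2 (him y)) (Complex.normSq_nonneg _)
        · simp [hf, hy] }
  have hu0 : ∀ y, R < ‖y‖ → u y = 0 := fun y hy => hd.field_eq_zero hk hy
  have hae := ae_eq_zero_of_norm_source_le (k := k) (m := |deltaMass / (4 * Real.pi)|)
    hd.toBddSupp ⟨hu.measurable, hC, hu0⟩ (abs_nonneg _) (fun c => le_of_eq ?_) hM0 hfu
  · exact congrFun (Continuous.ae_eq_iff_eq volume hu continuous_zero |>.1 hae) x
  · rw [laplaceT_field hd.toBddSupp hd.field hu0, norm_mul, ← Real.norm_eq_abs,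
      ← Complex.norm_real]
    push_cast
    rfl

/-- For `k > 0`, a bounded open `Ω ⊂ ℝ³`, and continuous `p` supported in the closure of
`Ω` with `Im p ≤ 0`: every bounded continuous solution of the homogeneous limiting
integral equation `u(x) = −∫_Ω G(x,y) p(y) u(y) dy` vanishes identically; consequently the
limiting integral equation `u(x) = u₀(x) − ∫_Ω G(x,y) p(y) u(y) dy` has at most one
bounded continuous solution for any given `u₀`. -/
theorem limiting_IE_uniqueness (k : ℝ) (hk : 0 < k)
    (Ω : Set E3) (hΩo : IsOpen Ω) (hΩb : Bornology.IsBounded Ω)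
    (p : E3 → ℂ) (hp : Continuous p) (hps : Function.support p ⊆ closure Ω)
    (him : ∀ y : E3, (p y).im ≤ 0) :
    (∀ u : E3 → ℂ, Continuous u → (∃ C : ℝ, ∀ x : E3, ‖u x‖ ≤ C) →
      (∀ x : E3, u x = -∫ y in Ω, greens k x y * (p y * u y)) →
      ∀ x : E3, u x = 0) ∧
    ∀ u₀ u₁ u₂ : E3 → ℂ,
      Continuous u₁ → (∃ C : ℝ, ∀ x : E3, ‖u₁ x‖ ≤ C) →
      Continuous u₂ → (∃ C : ℝ, ∀ x : E3, ‖u₂ x‖ ≤ C) →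
      (∀ x : E3, u₁ x = u₀ x - ∫ y in Ω, greens k x y * (p y * u₁ y)) →
      (∀ x : E3, u₂ x = u₀ x - ∫ y in Ω, greens k x y * (p y * u₂ y)) →
      u₁ = u₂ := by
  obtain ⟨R, hR⟩ := hΩb.subset_closedBall 0
  have hpc : HasCompactSupport p :=
    hΩb.isCompact_closure.of_isClosed_subset (isClosed_tsupport p)
      (closure_minimal hps isClosed_closure)
  obtain ⟨M, hM⟩ := hp.bounded_above_of_compact_support hpc
  have key := fun u hu C hC h =>
    homogeneous_solution_eq_zero (C := C) (u := u) hk hΩo hR hp.measurable hM him hu hC h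
  refine ⟨fun u hu ⟨C, hC⟩ h => key u hu C hC h, ?_⟩
  intro u₀ u₁ u₂ hu₁ ⟨C₁, hC₁⟩ hu₂ ⟨C₂, hC₂⟩ h₁ h₂
  have hint : ∀ u : E3 → ℂ, Continuous u → ∀ x,
      IntegrableOn (fun y => greens k x y * (p y * u y)) Ω := by
    intro u hu x
    obtain ⟨R', B, hB⟩ := BddSupp.exists_of_continuous (hp.mul hu) hpc.mul_right
    exact (hB.integrable_mul (integrableOn_greens k R' x)).integrableOn
  funext x
  refine sub_eq_zero.1 (key (fun y => u₁ y - u₂ y) (hu₁.sub hu₂) (C₁ + C₂)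
    (fun y => (norm_sub_le _ _).trans (add_le_add (hC₁ y) (hC₂ y))) (fun y => ?_) x)
  simp only [mul_sub]
  rw [integral_sub (hint u₁ hu₁ y) (hint u₂ hu₂ y), h₁ y, h₂ y]
  ring

end
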